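/- arXiv:1312.3955 — 2 statements merged into one kernel-verified Lean document; each statement's English description precedes it below -/
import Mathlib

section
/- Let k ≥ 1 and σ ∈ S_k. For each n, let π_n be a uniformly random permutation of S_n and let X_σ^{(n)} := N_σ(π_n). Then, as n → ∞, the random variable (X_σ^{(n)} − binom(n,k)/k!)/n^{k−1/2} converges in distribution to the centered Gaussian distribution on ℝ with variance Σ_{σ,σ} := ∫₀¹∫₀¹ G_σ(x,y)² dx dy. -/
open MeasureTheory ProbabilityTheory Filter

/-- The number of occurrences of the pattern `s` in `S_k` in the permutation `p` in `S_n`. -/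
def occ {k n : ℕ} (σ : Equiv.Perm (Fin k)) (π : Equiv.Perm (Fin n)) : ℕ :=
  (Finset.univ.filter (fun f : Fin k → Fin n =>
    (∀ a b : Fin k, a < b → f a < f b) ∧
    (∀ a b : Fin k, π (f a) < π (f b) ↔ σ a < σ b))).card

/-- `g_{k,i}(x) = C(k-1, i-1) x^{i-1} (1-x)^{k-i}`. -/
noncomputable def g (k i : ℕ) (x : ℝ) : ℝ :=
  ((k - 1).choose (i - 1) : ℝ) * x ^ (i - 1) * (1 - x) ^ (k - i)

/-- `G_s(x,y)` from the paper (indices one-indexed). -/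
noncomputable def G {k : ℕ} (σ : Equiv.Perm (Fin k)) (x y : ℝ) : ℝ :=
  (1 / ((k - 1).factorial : ℝ) ^ 2) *
    (∑ i : Fin k, g k ((i : ℕ) + 1) x * g k (((σ i : Fin k) : ℕ) + 1) y - 1 / (k : ℝ))

/-- The discrete measurable structure on the finite set of permutations of `Fin n`. -/
instance {n : ℕ} : MeasurableSpace (Equiv.Perm (Fin n)) := ⊤

section ProductMeasure

variable {E : Type*} [MeasurableSpace E] (μ : Measure E) [IsProbabilityMeasure μ]

/-- Resampling the coordinates in `S` of an i.i.d. family does not change its law. -/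
lemma measurePreserving_piecewise {ι : Type*} (S : Set ι) [∀ i, Decidable (i ∈ S)] :
    MeasurePreserving (fun p : (ι → E) × (ι → E) => S.piecewise p.2 p.1)
      ((Measure.infinitePi fun _ : ι => μ).prod (Measure.infinitePi fun _ : ι => μ))
      (Measure.infinitePi fun _ : ι => μ) := by
  have hm : Measurable (fun p : (ι → E) × (ι → E) => S.piecewise p.2 p.1) := by
    refine measurable_pi_lambda _ fun i => ?_
    by_cases hi : i ∈ S
    · simp only [Set.piecewise, hi, if_true]; fun_prop
    · simp only [Set.piecewise, hi, if_false]; fun_prop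
  refine ⟨hm, Measure.eq_infinitePi _ fun s t ht => ?_⟩
  rw [Measure.map_apply hm (.pi s.countable_toSet fun i _ => ht i)]
  have : (fun p : (ι → E) × (ι → E) => S.piecewise p.2 p.1) ⁻¹' (Set.pi s t) =
      (Set.pi (s.filter (· ∉ S) : Finset ι) t) ×ˢ (Set.pi (s.filter (· ∈ S) : Finset ι) t) := by
    ext p
    simp only [Set.mem_preimage, Set.mem_pi, Set.mem_prod, Finset.coe_filter, Set.mem_ofPred_eq,
      Finset.mem_coe, Set.piecewise]
    constructor
    · intro h
      exact ⟨fun i hi => by simpa [hi.2] using h i hi.1, fun i hi => by simpa [hi.2] using h i hi.1⟩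
    · rintro ⟨h1, h2⟩ i hi
      by_cases hS : i ∈ S
      · simpa [hS] using h2 i ⟨hi, hS⟩
      · simpa [hS] using h1 i ⟨hi, hS⟩
  rw [this, Measure.prod_prod, Measure.infinitePi_pi _ fun i _ => ht i,
    Measure.infinitePi_pi _ fun i _ => ht i, mul_comm]
  exact Finset.prod_filter_mul_prod_filter_not s (· ∈ S) _

/-- Restricting an i.i.d. family along an injection gives an i.i.d. family. -/
lemma measurePreserving_comp_injective {ι κ : Type*} {f : κ → ι} (hf : Function.Injective f) :
    MeasurePreserving (fun (ω : ι → E) i => ω (f i))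
      (Measure.infinitePi fun _ : ι => μ) (Measure.infinitePi fun _ : κ => μ) :=
  ⟨by fun_prop, Measure.map_infinitePi_infinitePi_of_inj hf⟩

lemma integral_comp_of_measurePreserving {Ω Ω' : Type*} [MeasurableSpace Ω] [MeasurableSpace Ω']
    {P : Measure Ω} {P' : Measure Ω'} {T : Ω → Ω'} (hT : MeasurePreserving T P P') {φ : Ω' → ℝ}
    (hφ : Measurable φ) : ∫ x, φ (T x) ∂P = ∫ y, φ y ∂P' := by
  rw [← hT.map_eq, integral_map hT.measurable.aemeasurable hφ.aestronglyMeasurable]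

lemma integrable_of_abs_le {Ω : Type*} [MeasurableSpace Ω] {P : Measure Ω} [IsFiniteMeasure P]
    {φ : Ω → ℝ} (hφ : Measurable φ) {C : ℝ} (hC : ∀ w, |φ w| ≤ C) : Integrable φ P :=
  Integrable.of_bound hφ.aestronglyMeasurable C (.of_forall hC)

/-- A kernel which is completely degenerate at order one gives uncorrelated evaluations along two
injections meeting in at most one point. -/
lemma integral_mul_eq_zero_of_degenerate {ι κ : Type*} [DecidableEq κ] {φ : (κ → E) → ℝ}
    (hφ : Measurable φ) {C : ℝ} (hC : ∀ w, |φ w| ≤ C)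
    (hdeg : ∀ a z, ∫ w, φ (Function.update w a z) ∂(Measure.infinitePi fun _ : κ => μ) = 0)
    {f f' : κ → ι} (hf : Function.Injective f) (a : κ)
    (ha : ∀ b, b ≠ a → f b ∉ Set.range f') :
    ∫ ω, φ (fun i => ω (f i)) * φ (fun i => ω (f' i)) ∂(Measure.infinitePi fun _ : ι => μ) = 0 := by
  classical
  set P := Measure.infinitePi fun _ : ι => μ
  let S : Set ι := f '' {b | b ≠ a}
  have hmp := measurePreserving_piecewise μ S
  have hmeas : Measurable fun ω : ι → E => φ (fun i => ω (f i)) * φ (fun i => ω (f' i)) :=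
    (hφ.comp (by fun_prop)).mul (hφ.comp (by fun_prop))
  have hbd : ∀ ω : ι → E, |φ (fun i => ω (f i)) * φ (fun i => ω (f' i))| ≤ C * C := fun ω => by
    rw [abs_mul]
    exact mul_le_mul (hC _) (hC _) (abs_nonneg _) ((abs_nonneg _).trans (hC fun i => ω (f i)))
  rw [← integral_comp_of_measurePreserving hmp hmeas]
  have hInt : Integrable (fun p : (ι → E) × (ι → E) =>
      φ (fun i => S.piecewise p.2 p.1 (f i)) * φ (fun i => S.piecewise p.2 p.1 (f' i)))
      (P.prod P) :=
    integrable_of_abs_le (hmeas.comp hmp.measurable) fun p => hbd _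
  rw [integral_prod _ hInt]
  have key : ∀ x : ι → E, ∫ y, φ (fun i => S.piecewise y x (f i)) *
      φ (fun i => S.piecewise y x (f' i)) ∂P = 0 := by
    intro x
    have h1 : ∀ y : ι → E, (fun i => S.piecewise y x (f' i)) = fun i => x (f' i) := by
      intro y
      ext i
      rw [Set.piecewise_eq_of_notMem]
      rintro ⟨b, hb, hbi⟩
      exact ha b hb ⟨i, hbi.symm⟩
    have h2 : ∀ y : ι → E, (fun i => S.piecewise y x (f i)) =
        Function.update (fun i => y (f i)) a (x (f a)) := by
      intro y
      ext i
      by_cases hi : i = a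
      · subst hi
        rw [Set.piecewise_eq_of_notMem, Function.update_self]
        rintro ⟨b, hb, hbi⟩
        exact hb (hf hbi)
      · rw [Set.piecewise_eq_of_mem _ _ _ (show f i ∈ S from ⟨i, hi, rfl⟩),
          Function.update_of_ne hi]
    simp_rw [h1, h2, integral_mul_const]
    rw [integral_comp_of_measurePreserving (measurePreserving_comp_injective μ hf)
      (φ := fun w => φ (Function.update w a (x (f a)))) (hφ.comp (by fun_prop)), hdeg, zero_mul]
  simp_rw [key, integral_zero]

end ProductMeasure

section SecondMoment

/-- The pairs of maps `κ → α` which agree at two prescribed pairs of arguments. -/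
lemma card_pairs_agreeing_mul_le {κ α : Type*} [Fintype κ] [DecidableEq κ] [Fintype α]
    [DecidableEq α] (b c b' c' : κ) (h : b' ≠ c') :
    (Finset.univ.filter fun p : (κ → α) × (κ → α) => p.1 b = p.2 b' ∧ p.1 c = p.2 c').card *
      Fintype.card α ^ 2 ≤ (Fintype.card α ^ Fintype.card κ) ^ 2 := by
  have h1 : Fintype.card α ^ 2 = (Finset.univ : Finset (α × α)).card := by
    rw [Finset.card_univ, Fintype.card_prod, sq]
  have h2 : (Fintype.card α ^ Fintype.card κ) ^ 2 =
      (Finset.univ : Finset ((κ → α) × (κ → α))).card := by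
    rw [Finset.card_univ, Fintype.card_prod, sq, Fintype.card_fun]
  rw [h1, h2, ← Finset.card_product]
  refine Finset.card_le_card_of_injOn
    (fun q => (q.1.1, Function.update (Function.update q.1.2 b' q.2.1) c' q.2.2))
    (fun _ _ => Finset.mem_coe.2 (Finset.mem_univ _)) ?_
  rintro ⟨⟨f, f'⟩, u, v⟩ hq ⟨⟨f₂, f₂'⟩, u₂, v₂⟩ hq₂ he
  simp only [Finset.coe_product, Set.mem_prod, Finset.mem_coe, Finset.mem_filter,
    Finset.mem_univ, true_and, and_true] at hq hq₂
  simp only [Prod.mk.injEq] at he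
  obtain ⟨rfl, he⟩ := he
  have hu : u = u₂ := by simpa [h] using congrFun he b'
  have hv : v = v₂ := by simpa using congrFun he c'
  have hf : f' = f₂' := by
    ext i
    by_cases hb : i = b'
    · subst hb; rw [← hq.1, ← hq₂.1]
    · by_cases hc : i = c'
      · subst hc; rw [← hq.2, ← hq₂.2]
      · simpa [hb, hc] using congrFun he i
  rw [hu, hv, hf]

/-- The injective maps from `Fin k` to `Fin n`. -/
def injections (k n : ℕ) : Finset (Fin k → Fin n) :=
  Finset.univ.filter Function.Injective

lemma mem_injections {k n : ℕ} {f : Fin k → Fin n} :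
    f ∈ injections k n ↔ Function.Injective f := by simp [injections]

/-- Ordered pairs of injections whose ranges meet in at least two points are rare. -/
lemma card_overlapping_mul_le {k n : ℕ} (hk : 1 ≤ k) :
    (((injections k n) ×ˢ (injections k n)).filter fun p =>
        ∀ a, ∃ b, b ≠ a ∧ p.1 b ∈ Set.range p.2).card * n ^ 2 ≤ k ^ 4 * (n ^ k) ^ 2 := by
  classical
  let U : Finset ((Fin k × Fin k) × (Fin k × Fin k)) :=
    Finset.univ.filter fun q => q.2.1 ≠ q.2.2
  let A : (Fin k × Fin k) × (Fin k × Fin k) → Finset ((Fin k → Fin n) × (Fin k → Fin n)) :=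
    fun q => Finset.univ.filter fun p => p.1 q.1.1 = p.2 q.2.1 ∧ p.1 q.1.2 = p.2 q.2.2
  have hsub : (((injections k n) ×ˢ (injections k n)).filter fun p =>
        ∀ a, ∃ b, b ≠ a ∧ p.1 b ∈ Set.range p.2) ⊆ U.biUnion A := by
    intro p hp
    simp only [Finset.mem_filter, Finset.mem_product, mem_injections] at hp
    obtain ⟨⟨hf, -⟩, hp⟩ := hp
    obtain ⟨b, -, b', hb⟩ := hp ⟨0, hk⟩
    obtain ⟨c, hcb, c', hc⟩ := hp b
    simp only [Finset.mem_biUnion, U, A, Finset.mem_filter, Finset.mem_univ, true_and]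
    refine ⟨((b, c), (b', c')), fun h => hcb (hf ?_), hb.symm, hc.symm⟩
    simp only at h
    rw [← hc, ← hb, h]
  have hU : U.card ≤ k ^ 4 := by
    refine (Finset.card_le_univ _).trans (le_of_eq ?_)
    simp only [Fintype.card_prod, Fintype.card_fin]
    ring
  calc _ ≤ (∑ q ∈ U, (A q).card) * n ^ 2 :=
        Nat.mul_le_mul_right _ ((Finset.card_le_card hsub).trans Finset.card_biUnion_le)
    _ = ∑ q ∈ U, (A q).card * n ^ 2 := Finset.sum_mul ..
    _ ≤ ∑ q ∈ U, (n ^ k) ^ 2 := by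
        refine Finset.sum_le_sum fun q hq => ?_
        simpa using card_pairs_agreeing_mul_le (α := Fin n) q.1.1 q.1.2 q.2.1 q.2.2
          (Finset.mem_filter.1 hq).2
    _ ≤ k ^ 4 * (n ^ k) ^ 2 := by
        rw [Finset.sum_const, smul_eq_mul]
        exact Nat.mul_le_mul_right _ hU

variable {E : Type*} [MeasurableSpace E] (μ : Measure E) [IsProbabilityMeasure μ]

/-- The sum of a kernel over all injective samples from the first `n` entries of a sequence. -/
def injSum {k : ℕ} (φ : (Fin k → E) → ℝ) (n : ℕ) (ω : ℕ → E) : ℝ :=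
  ∑ f ∈ injections k n, φ fun i => ω (f i)

lemma measurable_injSum {k : ℕ} {φ : (Fin k → E) → ℝ} (hφ : Measurable φ) (n : ℕ) :
    Measurable (injSum φ n) :=
  Finset.measurable_fun_sum _ fun _ _ => hφ.comp (by fun_prop)

lemma integral_injSum_sq_mul_le {k : ℕ} (hk : 1 ≤ k) {φ : (Fin k → E) → ℝ}
    (hφ : Measurable φ) {C : ℝ} (hC : ∀ w, |φ w| ≤ C)
    (hdeg : ∀ a z, ∫ w, φ (Function.update w a z) ∂(Measure.infinitePi fun _ : Fin k => μ) = 0)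
    (n : ℕ) :
    (∫ ω, injSum φ n ω ^ 2 ∂(Measure.infinitePi fun _ : ℕ => μ)) * (n : ℝ) ^ 2 ≤
      C ^ 2 * (k : ℝ) ^ 4 * ((n : ℝ) ^ k) ^ 2 := by
  classical
  set P := Measure.infinitePi fun _ : ℕ => μ
  let J := (injections k n) ×ˢ (injections k n)
  let F : (Fin k → Fin n) × (Fin k → Fin n) → (ℕ → E) → ℝ :=
    fun p ω => φ (fun i => ω (p.1 i)) * φ (fun i => ω (p.2 i))
  have hFb : ∀ p ω, |F p ω| ≤ C ^ 2 := fun p ω => by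
    rw [abs_mul, sq]
    exact mul_le_mul (hC _) (hC _) (abs_nonneg _) ((abs_nonneg _).trans (hC fun i => ω (p.1 i)))
  have hFi : ∀ p, Integrable (F p) P := fun p =>
    integrable_of_abs_le ((hφ.comp (by fun_prop)).mul (hφ.comp (by fun_prop))) (hFb p)
  have h1 : ∫ ω, injSum φ n ω ^ 2 ∂P = ∑ p ∈ J, ∫ ω, F p ω ∂P := by
    rw [← integral_finsetSum _ fun p _ => hFi p]
    refine integral_congr_ae (.of_forall fun ω => ?_)
    simp only [injSum, sq, Finset.sum_mul_sum, J, F, Finset.sum_product]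
  have h2 : ∑ p ∈ J, ∫ ω, F p ω ∂P = ∑ p ∈ J.filter fun p =>
      ∀ a, ∃ b, b ≠ a ∧ p.1 b ∈ Set.range p.2, ∫ ω, F p ω ∂P := by
    refine (Finset.sum_filter_of_ne fun p hp hne => ?_).symm
    by_contra! hcon
    obtain ⟨a, ha⟩ := hcon
    simp only [J, Finset.mem_product, mem_injections] at hp
    refine hne (integral_mul_eq_zero_of_degenerate μ hφ hC hdeg
      (f := fun i => (p.1 i : ℕ)) (f' := fun i => (p.2 i : ℕ))
      (Fin.val_injective.comp hp.1) a fun b hb => ?_)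
    rintro ⟨c, hc⟩
    exact ha b hb ⟨c, Fin.ext hc⟩
  have h3 : ∀ p, ∫ ω, F p ω ∂P ≤ C ^ 2 := fun p => by
    calc ∫ ω, F p ω ∂P ≤ ∫ _, C ^ 2 ∂P :=
          integral_mono (hFi p) (integrable_const _) fun ω => (le_abs_self _).trans (hFb p ω)
      _ = C ^ 2 := by simp
  rw [h1, h2]
  calc _ ≤ (∑ p ∈ J.filter fun p => ∀ a, ∃ b, b ≠ a ∧ p.1 b ∈ Set.range p.2, C ^ 2) *
        (n : ℝ) ^ 2 := by gcongr; exact h3 _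
    _ = C ^ 2 * (((J.filter fun p => ∀ a, ∃ b, b ≠ a ∧ p.1 b ∈ Set.range p.2).card * n ^ 2 : ℕ)
        : ℝ) := by
        rw [Finset.sum_const, nsmul_eq_mul]; push_cast; ring
    _ ≤ C ^ 2 * ((k ^ 4 * (n ^ k) ^ 2 : ℕ) : ℝ) := by
        refine mul_le_mul_of_nonneg_left (Nat.cast_le.2 ?_) (sq_nonneg C)
        convert card_overlapping_mul_le (n := n) hk
    _ = _ := by push_cast; ring

end SecondMoment

section HoeffdingProjection

variable {E : Type*} [MeasurableSpace E] (μ : Measure E) [IsProbabilityMeasure μ] {k : ℕ}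

/-- The conditional expectation of the kernel `ψ` given that its `a`-th argument equals `z`. -/
noncomputable def condMean (ψ : (Fin k → E) → ℝ) (a : Fin k) (z : E) : ℝ :=
  ∫ w, ψ (Function.update w a z) ∂(Measure.infinitePi fun _ : Fin k => μ)

/-- The mean of a kernel. -/
noncomputable def kernelMean (ψ : (Fin k → E) → ℝ) : ℝ :=
  ∫ w, ψ w ∂(Measure.infinitePi fun _ : Fin k => μ)

/-- The first order term of the Hoeffding decomposition of a kernel. -/
noncomputable def firstProjection (ψ : (Fin k → E) → ℝ) (z : E) : ℝ :=
  ∑ a, (condMean μ ψ a z - kernelMean μ ψ)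

/-- What is left of a kernel after its mean and its first order projections are removed. -/
noncomputable def degeneratePart (ψ : (Fin k → E) → ℝ) (w : Fin k → E) : ℝ :=
  ψ w - kernelMean μ ψ - ∑ a, (condMean μ ψ a (w a) - kernelMean μ ψ)

variable {ψ : (Fin k → E) → ℝ}

lemma measurable_update_pair (a : Fin k) :
    Measurable fun p : E × (Fin k → E) => Function.update p.2 a p.1 := by
  refine measurable_pi_lambda _ fun i => ?_
  by_cases hi : i = a
  · subst hi; simpa using measurable_fst
  · simp only [Function.update_of_ne hi]; fun_prop

lemma abs_integral_le_of_abs_le {Ω : Type*} [MeasurableSpace Ω] {P : Measure Ω}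
    [IsProbabilityMeasure P] {φ : Ω → ℝ} {C : ℝ} (hC : ∀ w, |φ w| ≤ C) : |∫ w, φ w ∂P| ≤ C := by
  simpa using norm_integral_le_of_norm_le_const (μ := P) (f := φ) (C := C) (.of_forall hC)

lemma measurable_condMean (hψ : Measurable ψ) (a : Fin k) : Measurable (condMean μ ψ a) := by
  have : StronglyMeasurable (fun p : E × (Fin k → E) => ψ (Function.update p.2 a p.1)) :=
    (hψ.comp (measurable_update_pair a)).stronglyMeasurable
  exact (this.integral_prod_right (ν := Measure.infinitePi fun _ : Fin k => μ)).measurable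

lemma abs_condMean_le {C : ℝ} (hC : ∀ w, |ψ w| ≤ C) (a : Fin k) (z : E) : |condMean μ ψ a z| ≤ C :=
  abs_integral_le_of_abs_le fun _ => hC _

lemma abs_kernelMean_le {C : ℝ} (hC : ∀ w, |ψ w| ≤ C) : |kernelMean μ ψ| ≤ C :=
  abs_integral_le_of_abs_le fun _ => hC _

lemma integral_condMean (hψ : Measurable ψ) {C : ℝ} (hC : ∀ w, |ψ w| ≤ C) (a : Fin k) :
    ∫ z, condMean μ ψ a z ∂μ = kernelMean μ ψ := by
  classical
  set P := Measure.infinitePi fun _ : Fin k => μ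
  have hmp := measurePreserving_piecewise μ ({a} : Set (Fin k))
  have hup : ∀ p : (Fin k → E) × (Fin k → E),
      ({a} : Set (Fin k)).piecewise p.2 p.1 = Function.update p.1 a (p.2 a) := fun p => by
    ext i
    by_cases hi : i = a
    · subst hi; simp
    · simp [hi]
  have h1 := integral_comp_of_measurePreserving hmp hψ
  simp only [hup] at h1
  rw [integral_prod_symm _ (integrable_of_abs_le ?_ (C := C) fun _ => hC _)] at h1
  · rw [kernelMean, ← h1]
    exact (integral_comp_of_measurePreserving (measurePreserving_eval_infinitePi (fun _ => μ) a)
      (measurable_condMean μ hψ a)).symm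
  · have hpair : Measurable fun p : (Fin k → E) × (Fin k → E) => (p.2 a, p.1) := by fun_prop
    exact hψ.comp ((measurable_update_pair a).comp hpair)

lemma measurable_firstProjection (hψ : Measurable ψ) : Measurable (firstProjection μ ψ) :=
  Finset.measurable_fun_sum _ fun a _ => (measurable_condMean μ hψ a).sub_const _

lemma measurable_degeneratePart (hψ : Measurable ψ) : Measurable (degeneratePart μ ψ) :=
  (hψ.sub_const _).sub (Finset.measurable_fun_sum _ fun a _ =>
    ((measurable_condMean μ hψ a).comp (measurable_pi_apply a)).sub_const _)

lemma abs_sum_condMean_sub_le {C : ℝ} (hC : ∀ w, |ψ w| ≤ C) (z : Fin k → E) :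
    |∑ a, (condMean μ ψ a (z a) - kernelMean μ ψ)| ≤ k * (C + C) := by
  refine (Finset.abs_sum_le_sum_abs _ _).trans ?_
  refine (Finset.sum_le_sum fun a _ => (abs_sub _ _).trans
    (add_le_add (abs_condMean_le μ hC a (z a)) (abs_kernelMean_le μ hC))).trans ?_
  simp [mul_add]

lemma abs_firstProjection_le {C : ℝ} (hC : ∀ w, |ψ w| ≤ C) (z : E) :
    |firstProjection μ ψ z| ≤ k * (C + C) :=
  abs_sum_condMean_sub_le μ hC fun _ => z

lemma abs_degeneratePart_le {C : ℝ} (hC : ∀ w, |ψ w| ≤ C) (w : Fin k → E) :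
    |degeneratePart μ ψ w| ≤ C + C + k * (C + C) :=
  (abs_sub _ _).trans (add_le_add ((abs_sub _ _).trans
    (add_le_add (hC w) (abs_kernelMean_le μ hC))) (abs_sum_condMean_sub_le μ hC w))

lemma integrable_condMean (hψ : Measurable ψ) {C : ℝ} (hC : ∀ w, |ψ w| ≤ C) (a : Fin k) :
    Integrable (condMean μ ψ a) μ :=
  integrable_of_abs_le (measurable_condMean μ hψ a) (abs_condMean_le μ hC a)

lemma integral_firstProjection (hψ : Measurable ψ) {C : ℝ} (hC : ∀ w, |ψ w| ≤ C) :
    ∫ z, firstProjection μ ψ z ∂μ = 0 := by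
  unfold firstProjection
  rw [integral_finsetSum (f := fun a z => condMean μ ψ a z - kernelMean μ ψ) _
    fun a _ => (integrable_condMean μ hψ hC a).sub (integrable_const _)]
  refine Finset.sum_eq_zero fun a _ => ?_
  rw [integral_sub (integrable_condMean μ hψ hC a) (integrable_const _),
    integral_condMean μ hψ hC]
  simp

lemma integral_degeneratePart_update (hψ : Measurable ψ) {C : ℝ} (hC : ∀ w, |ψ w| ≤ C)
    (a : Fin k) (z : E) :
    ∫ w, degeneratePart μ ψ (Function.update w a z) ∂(Measure.infinitePi fun _ : Fin k => μ) =
      0 := by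
  set P := Measure.infinitePi fun _ : Fin k => μ
  have hup : Measurable fun w : Fin k → E => Function.update w a z := by fun_prop
  have i1 : Integrable (fun w => ψ (Function.update w a z)) P :=
    integrable_of_abs_le (hψ.comp hup) fun _ => hC _
  have i2 : ∀ b, Integrable (fun w : Fin k → E =>
      condMean μ ψ b (Function.update w a z b) - kernelMean μ ψ) P := fun b =>
    (integrable_of_abs_le ((measurable_condMean μ hψ b).comp ((measurable_pi_apply b).comp hup))
      fun w => abs_condMean_le μ hC b _).sub (integrable_const _)
  have i4 : Integrable (fun w => ψ (Function.update w a z) - kernelMean μ ψ) P :=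
    i1.sub (integrable_const _)
  unfold degeneratePart
  rw [integral_sub i4 (integrable_finsetSum _ fun b _ => i2 b),
    integral_sub i1 (integrable_const _), integral_finsetSum _ fun b _ => i2 b,
    Finset.sum_eq_single a]
  · simp [condMean, P]
  · intro b _ hb
    have i3 : Integrable (fun w : Fin k → E => condMean μ ψ b (w b)) P :=
      integrable_of_abs_le ((measurable_condMean μ hψ b).comp (measurable_pi_apply b))
        fun w => abs_condMean_le μ hC b _
    simp_rw [Function.update_of_ne hb]
    rw [integral_sub i3 (integrable_const _), integral_comp_of_measurePreserving
      (measurePreserving_eval_infinitePi (fun _ => μ) b) (measurable_condMean μ hψ b),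
      integral_condMean μ hψ hC]
    simp
  · simp

end HoeffdingProjection

section InjectiveSums

lemma card_injections (k n : ℕ) : (injections k n).card = n.descFactorial k := by
  rw [injections, ← Fintype.card_subtype,
    Fintype.card_congr (Equiv.subtypeInjectiveEquivEmbedding (Fin k) (Fin n)),
    Fintype.card_embedding_eq, Fintype.card_fin, Fintype.card_fin]

/-- Each coordinate of a uniformly random injection is uniformly distributed. -/
lemma mul_sum_injections_apply {k n : ℕ} (a : Fin k) (u : Fin n → ℝ) :
    (n : ℝ) * ∑ f ∈ injections k n, u (f a) = (n.descFactorial k : ℝ) * ∑ i, u i := by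
  have hfib : ∀ i j : Fin n, ((injections k n).filter fun f => f a = i).card =
      ((injections k n).filter fun f => f a = j).card := by
    intro i j
    refine Finset.card_bij' (fun f _ => Equiv.swap i j ∘ f) (fun f _ => Equiv.swap i j ∘ f)
      ?_ ?_ ?_ ?_
    · simp only [Finset.mem_filter, mem_injections]
      rintro f ⟨hf, rfl⟩
      exact ⟨(Equiv.swap _ j).injective.comp hf, by simp⟩
    · simp only [Finset.mem_filter, mem_injections]
      rintro f ⟨hf, rfl⟩
      exact ⟨(Equiv.swap i _).injective.comp hf, by simp⟩
    · intro f _; ext; simp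
    · intro f _; ext; simp
  have hsum : ∀ v : Fin n → ℝ, ∑ f ∈ injections k n, v (f a) =
      ∑ i, (((injections k n).filter fun f => f a = i).card : ℝ) * v i := by
    intro v
    rw [← Finset.sum_fiberwise_of_maps_to (s := injections k n) (t := Finset.univ)
      (g := fun f => f a) (fun _ _ => Finset.mem_univ _)]
    refine Finset.sum_congr rfl fun i _ => ?_
    rw [← nsmul_eq_mul, ← Finset.sum_const]
    exact Finset.sum_congr rfl fun f hf => by rw [(Finset.mem_filter.1 hf).2]
  have hone := hsum fun _ => 1
  simp only [Finset.sum_const, card_injections, nsmul_eq_mul, mul_one] at hone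
  rw [hsum u, hone, Finset.mul_sum, Finset.mul_sum]
  refine Finset.sum_congr rfl fun i _ => ?_
  rw [Finset.sum_congr rfl fun j _ => by rw [hfib j i]]
  simp only [Finset.sum_const, Finset.card_univ, Fintype.card_fin, nsmul_eq_mul]
  ring

lemma mul_injSum_degeneratePart {E : Type*} [MeasurableSpace E] (μ : Measure E) {k : ℕ}
    (ψ : (Fin k → E) → ℝ) (n : ℕ) (ω : ℕ → E) :
    (n : ℝ) * injSum (degeneratePart μ ψ) n ω =
      n * (injSum ψ n ω - n.descFactorial k * kernelMean μ ψ) -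
        n.descFactorial k * ∑ i ∈ Finset.range n, firstProjection μ ψ (ω i) := by
  have h : ∑ f ∈ injections k n, ∑ a, (condMean μ ψ a (ω (f a)) - kernelMean μ ψ) =
      ∑ a, ∑ f ∈ injections k n, (condMean μ ψ a (ω (f a)) - kernelMean μ ψ) :=
    Finset.sum_comm
  have h2 : ∑ i ∈ Finset.range n, firstProjection μ ψ (ω i) =
      ∑ a, ∑ i : Fin n, (condMean μ ψ a (ω i) - kernelMean μ ψ) := by
    rw [Finset.sum_range, Finset.sum_comm]
    rfl
  have h3 : injSum (degeneratePart μ ψ) n ω = injSum ψ n ω - n.descFactorial k * kernelMean μ ψ -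
      ∑ f ∈ injections k n, ∑ a, (condMean μ ψ a (ω (f a)) - kernelMean μ ψ) := by
    simp only [injSum, degeneratePart]
    rw [Finset.sum_sub_distrib, Finset.sum_sub_distrib]
    simp [card_injections]
  rw [h3, h, h2, mul_sub, Finset.mul_sum (s := (Finset.univ : Finset (Fin k))), Finset.mul_sum]
  congr 1
  exact Finset.sum_congr rfl fun a _ =>
    mul_sum_injections_apply a fun i : Fin n => condMean μ ψ a (ω i) - kernelMean μ ψ

end InjectiveSums

section CentralLimitTheorem

variable {E : Type*} [MeasurableSpace E] (μ : Measure E) [IsProbabilityMeasure μ] {k : ℕ}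

lemma tendstoInDistribution_sum_of_centered {H : E → ℝ} (hH : Measurable H) {C : ℝ}
    (hC : ∀ z, |H z| ≤ C) (h0 : ∫ z, H z ∂μ = 0) :
    TendstoInDistribution
      (fun (n : ℕ) (ω : ℕ → E) => (√(n : ℝ))⁻¹ * ∑ i ∈ Finset.range n, H (ω i)) atTop (id : ℝ → ℝ)
      (fun _ => Measure.infinitePi fun _ : ℕ => μ)
      (gaussianReal 0 (∫ z, H z ^ 2 ∂μ).toNNReal) := by
  set P := Measure.infinitePi fun _ : ℕ => μ
  have hev : ∀ i, MeasurePreserving (fun ω : ℕ → E => ω i) P μ :=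
    measurePreserving_eval_infinitePi fun _ => μ
  have hHm : ∀ i, Measurable fun ω : ℕ → E => H (ω i) := fun i => hH.comp (measurable_pi_apply i)
  have hmean : ∫ ω, H (ω 0) ∂P = 0 := by
    rw [integral_comp_of_measurePreserving (hev 0) hH, h0]
  have hvar : Var[fun ω : ℕ → E => H (ω 0); P] = ∫ z, H z ^ 2 ∂μ := by
    rw [variance_eq_integral (hHm 0).aemeasurable, hmean]
    simp only [sub_zero]
    exact integral_comp_of_measurePreserving (hev 0) (hH.pow_const 2)
  have hY : HasLaw (id : ℝ → ℝ) (gaussianReal 0 Var[fun ω : ℕ → E => H (ω 0); P].toNNReal)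
      (gaussianReal 0 (∫ z, H z ^ 2 ∂μ).toNNReal) :=
    ⟨by fun_prop, by rw [hvar, Measure.map_id]⟩
  have hindep : iIndepFun (fun (i : ℕ) (ω : ℕ → E) => H (ω i)) P :=
    iIndepFun_infinitePi (X := fun _ => H) fun _ => hH
  have hident : ∀ i : ℕ, IdentDistrib (fun ω : ℕ → E => H (ω i)) (fun ω => H (ω 0)) P P := by
    intro i
    refine ⟨(hHm i).aemeasurable, (hHm 0).aemeasurable, ?_⟩
    have hmap : ∀ j, P.map (fun ω => H (ω j)) = μ.map H := fun j => by
      rw [← (hev j).map_eq, Measure.map_map hH (hev j).measurable, Function.comp_def]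
    rw [hmap, hmap]
  have hL2 : MemLp (fun ω : ℕ → E => H (ω 0)) 2 P :=
    MemLp.of_bound (hHm 0).aestronglyMeasurable C (.of_forall fun ω => hC _)
  have h := tendstoInDistribution_inv_sqrt_mul_sum_sub
    (X := fun (i : ℕ) (ω : ℕ → E) => H (ω i)) (P := P) hY hL2 hindep hident
  simp only [hmean, mul_zero, sub_zero] at h
  exact h

lemma tendstoInMeasure_zero_of_tendsto_integral_sq {Ω : Type*} [MeasurableSpace Ω] {P : Measure Ω}
    [IsFiniteMeasure P] {R : ℕ → Ω → ℝ} (hInt : ∀ n, Integrable (fun ω => R n ω ^ 2) P)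
    (h : Tendsto (fun n => ∫ ω, R n ω ^ 2 ∂P) atTop (nhds 0)) :
    TendstoInMeasure P R atTop (fun _ => 0) := by
  rw [tendstoInMeasure_iff_measureReal_norm]
  intro ε hε
  have hle : ∀ n, P.real {x | ε ≤ ‖R n x - 0‖} ≤ (∫ ω, R n ω ^ 2 ∂P) / ε ^ 2 := by
    intro n
    rw [le_div_iff₀ (by positivity), mul_comm]
    have hset : {x | ε ≤ ‖R n x - 0‖} = {x | ε ^ 2 ≤ R n x ^ 2} := by
      ext x
      simp only [sub_zero, Real.norm_eq_abs, Set.mem_ofPred_eq]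
      rw [sq_le_sq, abs_of_pos hε]
    rw [hset]
    exact mul_meas_ge_le_integral_of_nonneg (.of_forall fun ω => sq_nonneg _) (hInt n) _
  refine squeeze_zero (fun n => measureReal_nonneg) hle ?_
  simpa using h.div_const (ε ^ 2)

/-- Central limit theorem for sums of a bounded kernel over injective samples. -/
theorem tendstoInDistribution_injSum (hk : 1 ≤ k) {ψ : (Fin k → E) → ℝ} (hψ : Measurable ψ)
    {C : ℝ} (hC : ∀ w, |ψ w| ≤ C) :
    TendstoInDistribution
      (fun (n : ℕ) (ω : ℕ → E) => (injSum ψ n ω - n.descFactorial k * kernelMean μ ψ) /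
        (n : ℝ) ^ ((k : ℝ) - 1 / 2)) atTop (id : ℝ → ℝ)
      (fun _ => Measure.infinitePi fun _ : ℕ => μ)
      (gaussianReal 0 (∫ z, firstProjection μ ψ z ^ 2 ∂μ).toNNReal) := by
  set P := Measure.infinitePi fun _ : ℕ => μ
  have hlin := tendstoInDistribution_sum_of_centered μ (measurable_firstProjection μ hψ)
    (abs_firstProjection_le μ hC) (integral_firstProjection μ hψ hC)
  have hpow : ∀ n : ℕ, 0 < n → (n : ℝ) ^ ((k : ℝ) - 1 / 2) * √(n : ℝ) = (n : ℝ) ^ k := by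
    intro n hn
    rw [Real.sqrt_eq_rpow, ← Real.rpow_add (by positivity), sub_add_cancel, Real.rpow_natCast]
  set D := C + C + k * (C + C)
  have hmeas := measurable_degeneratePart μ hψ
  have hbd : ∀ w, |degeneratePart μ ψ w| ≤ D := abs_degeneratePart_le μ hC
  set R : ℕ → (ℕ → E) → ℝ := fun n ω =>
    injSum (degeneratePart μ ψ) n ω / (n : ℝ) ^ ((k : ℝ) - 1 / 2)
  have hRm : ∀ n, Measurable (R n) := fun n => (measurable_injSum hmeas n).div_const _
  have hRint : ∀ n, Integrable (fun ω => R n ω ^ 2) P := by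
    intro n
    refine MemLp.integrable_sq (MemLp.of_bound (hRm n).aestronglyMeasurable
      ((∑ f ∈ injections k n, D) / (n : ℝ) ^ ((k : ℝ) - 1 / 2)) (.of_forall fun ω => ?_))
    rw [norm_div, Real.norm_of_nonneg (r := (n : ℝ) ^ _) (by positivity)]
    gcongr
    exact (Finset.abs_sum_le_sum_abs _ _).trans (Finset.sum_le_sum fun f _ => hbd _)
  have hR : TendstoInMeasure P R atTop (fun _ => 0) := by
    refine tendstoInMeasure_zero_of_tendsto_integral_sq hRint ?_
    have hle : ∀ n : ℕ, ∫ ω, R n ω ^ 2 ∂P ≤ D ^ 2 * k ^ 4 / n := by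
      intro n
      rcases Nat.eq_zero_or_pos n with rfl | hn
      · have : injections k 0 = ∅ := by
          refine Finset.eq_empty_of_forall_notMem fun f _ => (f ⟨0, hk⟩).elim0
        simp [R, injSum, this]
      · have hn' : (0 : ℝ) < n := by exact_mod_cast hn
        have h := integral_injSum_sq_mul_le μ hk hmeas hbd
          (integral_degeneratePart_update μ hψ hC) n
        have hp : 0 < (n : ℝ) ^ ((k : ℝ) - 1 / 2) := by positivity
        simp only [R, div_pow]
        rw [integral_div, div_le_div_iff₀ (by positivity) hn']
        rw [← hpow n hn, mul_pow, Real.sq_sqrt hn'.le] at h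
        refine le_of_mul_le_mul_right ?_ hn'
        linarith
    refine squeeze_zero (fun n => integral_nonneg fun ω => sq_nonneg _) hle ?_
    exact tendsto_const_div_atTop_nhds_zero_nat _
  have hc : Tendsto (fun n : ℕ => (n.descFactorial k : ℝ) / (n : ℝ) ^ k) atTop (nhds 1) := by
    refine (Asymptotics.isEquivalent_iff_tendsto_one ?_).1 (isEquivalent_descFactorial k)
    filter_upwards [eventually_gt_atTop 0] with n hn
    positivity
  have hcm : TendstoInMeasure P (fun (n : ℕ) _ => (n.descFactorial k : ℝ) / (n : ℝ) ^ k) atTop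
      (fun _ => 1) :=
    tendstoInMeasure_of_tendsto_ae (fun _ => aestronglyMeasurable_const) (.of_forall fun _ => hc)
  have h1 := hlin.continuous_comp_prodMk_of_tendstoInMeasure_const
    (g := fun x : ℝ × ℝ => x.1 * x.2) (by fun_prop) hcm fun _ => aemeasurable_const
  have h2 := h1.add_of_tendstoInMeasure_const hR fun n => (hRm n).aemeasurable
  convert! h2 using 1
  · ext n ω
    rcases Nat.eq_zero_or_pos n with rfl | hn
    · have : injections k 0 = ∅ := by
        refine Finset.eq_empty_of_forall_notMem fun f _ => (f ⟨0, hk⟩).elim0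
      have hk0 : k ≠ 0 := by omega
      obtain ⟨j, rfl⟩ := Nat.exists_eq_succ_of_ne_zero hk0
      simp [R, injSum, this]
    · have hn' : (0 : ℝ) < n := by exact_mod_cast hn
      have h := mul_injSum_degeneratePart μ ψ n ω
      have hp : 0 < (n : ℝ) ^ ((k : ℝ) - 1 / 2) := by positivity
      have hs : 0 < √(n : ℝ) := Real.sqrt_pos.2 hn'
      simp only [R, Pi.add_apply]
      rw [← hpow n hn]
      have hs2 : √(n : ℝ) ^ 2 = n := Real.sq_sqrt hn'.le
      field_simp
      rw [hs2]
      linarith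
  · ext x; simp

end CentralLimitTheorem

section RandomPoints

/-- The indicator that the points `w 0, …, w (k - 1)`, read from left to right, are in increasing
horizontal order and form the pattern `σ`. -/
noncomputable def patternKernel {k : ℕ} (σ : Equiv.Perm (Fin k)) (w : Fin k → ℝ × ℝ) : ℝ :=
  open Classical in
  if StrictMono (fun i => (w i).1) ∧ ∀ a b, (w a).2 < (w b).2 ↔ σ a < σ b then 1 else 0

lemma measurableSet_strictMono {k : ℕ} : MeasurableSet {v : Fin k → ℝ | StrictMono v} := by
  have : {v : Fin k → ℝ | StrictMono v} =
      ⋂ (a : Fin k) (b : Fin k) (_ : a < b), {v | v a < v b} := by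
    ext v
    simp only [Set.mem_ofPred_eq, Set.mem_iInter]
    exact ⟨fun h a b hab => h hab, fun h a b hab => h a b hab⟩
  rw [this]
  exact .iInter fun a => .iInter fun b => .iInter fun _ =>
    measurableSet_lt (measurable_pi_apply a) (measurable_pi_apply b)

lemma lt_iff_perm_lt_iff_strictMono {k : ℕ} (σ : Equiv.Perm (Fin k)) (v : Fin k → ℝ) :
    (∀ a b, v a < v b ↔ σ a < σ b) ↔ StrictMono (v ∘ σ.symm) := by
  constructor
  · intro h a b hab
    exact (h _ _).2 (by simpa using hab)
  · intro h a b
    simpa using h.lt_iff_lt (a := σ a) (b := σ b)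

/-- The indicator of strictly increasing vectors. -/
noncomputable def incr {k : ℕ} (v : Fin k → ℝ) : ℝ :=
  {v : Fin k → ℝ | StrictMono v}.indicator 1 v

lemma measurable_incr {k : ℕ} : Measurable (incr : (Fin k → ℝ) → ℝ) :=
  measurable_one.indicator measurableSet_strictMono

lemma abs_incr_le {k : ℕ} (v : Fin k → ℝ) : |incr v| ≤ 1 := by
  by_cases h : StrictMono v <;> simp [incr, h]

lemma patternKernel_eq_mul {k : ℕ} (σ : Equiv.Perm (Fin k)) (w : Fin k → ℝ × ℝ) :
    patternKernel σ w = incr (fun i => (w i).1) * incr (fun i => (w (σ.symm i)).2) := by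
  have h := lt_iff_perm_lt_iff_strictMono σ fun i => (w i).2
  simp only [Function.comp_def] at h
  simp only [patternKernel, incr, h]
  by_cases h1 : StrictMono fun i => (w i).1 <;>
    by_cases h2 : StrictMono fun i => (w (σ.symm i)).2 <;> simp [h1, h2]

lemma measurable_patternKernel {k : ℕ} (σ : Equiv.Perm (Fin k)) :
    Measurable (patternKernel σ) := by
  have : patternKernel σ = fun w => incr (fun i => (w i).1) * incr (fun i => (w (σ.symm i)).2) :=
    funext (patternKernel_eq_mul σ)
  rw [this]
  exact (measurable_incr.comp (by fun_prop)).mul (measurable_incr.comp (by fun_prop))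

lemma abs_patternKernel_le {k : ℕ} (σ : Equiv.Perm (Fin k)) (w : Fin k → ℝ × ℝ) :
    |patternKernel σ w| ≤ 1 := by
  rw [patternKernel]; split_ifs <;> simp

/-- The number of occurrences of `σ` among points with given coordinates. -/
noncomputable def pointCount {k n : ℕ} (σ : Equiv.Perm (Fin k)) (p : (Fin n → ℝ) × (Fin n → ℝ)) :
    ℝ :=
  ∑ f ∈ injections k n, patternKernel σ fun i => (p.1 (f i), p.2 (f i))

lemma measurable_pointCount {k n : ℕ} (σ : Equiv.Perm (Fin k)) :
    Measurable (pointCount σ : (Fin n → ℝ) × (Fin n → ℝ) → ℝ) :=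
  Finset.measurable_fun_sum _ fun f _ => (measurable_patternKernel σ).comp
    (measurable_pi_lambda _ fun i => by fun_prop)

lemma pointCount_eq_occ {k n : ℕ} (σ : Equiv.Perm (Fin k)) {x y : Fin n → ℝ}
    {τ s : Equiv.Perm (Fin n)} (hx : StrictMono (x ∘ τ)) (hy : StrictMono (y ∘ s))
    (ρ : Equiv.Perm (Fin n)) :
    pointCount σ (x, y ∘ ρ) = occ σ (s⁻¹ * ρ * τ) := by
  classical
  simp only [pointCount, patternKernel, Finset.sum_boole, occ, Nat.cast_inj, Finset.filter_filter,
    injections]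
  have hx' : ∀ i j, x (τ i) < x (τ j) ↔ i < j := fun i j => hx.lt_iff_lt
  have hy' : ∀ i j, y i < y j ↔ s⁻¹ i < s⁻¹ j := fun i j => by
    simpa using hy.lt_iff_lt (a := s⁻¹ i) (b := s⁻¹ j)
  refine (Finset.card_equiv (Equiv.arrowCongr (Equiv.refl _) τ) fun f => ?_).symm
  rw [Finset.mem_filter, Finset.mem_filter]
  simp only [Finset.mem_univ, true_and, Equiv.arrowCongr_apply, Equiv.refl_symm,
    Equiv.coe_refl, Function.comp_def, id, hy', Equiv.Perm.mul_apply]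
  constructor
  · rintro ⟨h1, h2⟩
    have h1' : StrictMono f := fun a b h => h1 a b h
    exact ⟨τ.injective.comp h1'.injective, fun a b h => (hx' _ _).2 (h1 a b h), h2⟩
  · rintro ⟨-, h1, h2⟩
    exact ⟨fun a b h => (hx' _ _).1 (h1 h), h2⟩

lemma exists_strictMono_comp_perm {n : ℕ} {x : Fin n → ℝ} (hx : Function.Injective x) :
    ∃ τ : Equiv.Perm (Fin n), StrictMono (x ∘ τ) :=
  ⟨Tuple.sort x, (Tuple.monotone_sort x).strictMono_of_injective
    (hx.comp (Tuple.sort x).injective)⟩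

variable (ν : Measure ℝ) [IsProbabilityMeasure ν]

lemma ae_injective_infinitePi [NullSingletonClass ν] {ι : Type*} [Countable ι] :
    ∀ᵐ x ∂(Measure.infinitePi fun _ : ι => ν), Function.Injective x := by
  have h : ∀ i j : ι, i ≠ j → ∀ᵐ x ∂(Measure.infinitePi fun _ : ι => ν), x i ≠ x j := by
    intro i j hij
    have hmap := Measure.infinitePi_map_eval_prod (P := fun _ : ι => ν) hij
    have hdiag : ∀ᵐ p ∂(ν.prod ν), p.1 ≠ p.2 := by
      have hm : MeasurableSet {p : ℝ × ℝ | p.1 ≠ p.2} :=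
        (measurableSet_eq_fun measurable_fst measurable_snd).compl
      rw [Measure.ae_prod_iff_ae_ae hm]
      refine .of_forall fun x => ?_
      have : ∀ᵐ y ∂ν, y ≠ x := by simp [ae_iff]
      filter_upwards [this] with y hy using hy.symm
    rw [← hmap] at hdiag
    exact ae_of_ae_map (f := fun ω : ι → ℝ => (ω i, ω j)) (p := fun q : ℝ × ℝ => q.1 ≠ q.2)
      (by fun_prop) hdiag
  have h' : ∀ᵐ x ∂(Measure.infinitePi fun _ : ι => ν), ∀ i j : ι, i ≠ j → x i ≠ x j := by
    rw [ae_all_iff]; intro i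
    rw [ae_all_iff]; intro j
    by_cases hij : i = j
    · simp [hij]
    · simpa [hij] using h i j hij
  filter_upwards [h'] with x hx i j hij
  by_contra hne
  exact hx i j hne hij

/-- Separating the two coordinates of a family of i.i.d. points of the plane. -/
lemma measurePreserving_coordinates (n : ℕ) :
    MeasurePreserving (fun (w : Fin n → ℝ × ℝ) => ((fun i => (w i).1, fun i => (w i).2) :
        (Fin n → ℝ) × (Fin n → ℝ)))
      (Measure.infinitePi fun _ : Fin n => ν.prod ν)
      ((Measure.infinitePi fun _ : Fin n => ν).prod (Measure.infinitePi fun _ : Fin n => ν)) := by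
  simp only [Measure.infinitePi_eq_pi]
  exact measurePreserving_arrowProdEquivProdArrow ℝ ℝ (Fin n) (fun _ => ν) (fun _ => ν)

/-- The number of occurrences of `σ` among `n` i.i.d. points with atomless independent coordinates
is distributed as the number of occurrences in a uniformly random permutation. -/
lemma integral_injSum_patternKernel [NullSingletonClass ν] {k n : ℕ} (σ : Equiv.Perm (Fin k))
    {F : ℝ → ℝ} (hF : Measurable F) {C : ℝ} (hC : ∀ x, |F x| ≤ C) :
    ∫ ω, F (injSum (patternKernel σ) n ω) ∂(Measure.infinitePi fun _ : ℕ => ν.prod ν) =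
      (∑ π : Equiv.Perm (Fin n), F (occ σ π)) / n.factorial := by
  set Q := Measure.infinitePi fun _ : Fin n => ν
  have h1 : ∫ ω, F (injSum (patternKernel σ) n ω) ∂(Measure.infinitePi fun _ : ℕ => ν.prod ν) =
      ∫ p, F (pointCount (n := n) σ p) ∂(Q.prod Q) := by
    have hmp := (measurePreserving_coordinates ν n).comp
      (measurePreserving_comp_injective (ν.prod ν) (Fin.val_injective (n := n)))
    exact integral_comp_of_measurePreserving hmp (hF.comp (measurable_pointCount σ))
  have h2 : ∀ ρ : Equiv.Perm (Fin n), ∫ p, F (pointCount σ (p.1, p.2 ∘ ρ)) ∂(Q.prod Q) =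
      ∫ p, F (pointCount (n := n) σ p) ∂(Q.prod Q) := by
    intro ρ
    have hmp := (MeasurePreserving.id Q).prod (measurePreserving_comp_injective ν ρ.injective)
    exact integral_comp_of_measurePreserving hmp (hF.comp (measurable_pointCount σ))
  have h3 : ∀ᵐ p ∂(Q.prod Q), ∑ ρ : Equiv.Perm (Fin n), F (pointCount σ (p.1, p.2 ∘ ρ)) =
      ∑ π : Equiv.Perm (Fin n), F (occ σ π) := by
    have hi : ∀ᵐ x ∂Q, Function.Injective x := ae_injective_infinitePi ν
    have hi1 : ∀ᵐ p ∂(Q.prod Q), Function.Injective p.1 :=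
      Measure.quasiMeasurePreserving_fst.ae hi
    have hi2 : ∀ᵐ p ∂(Q.prod Q), Function.Injective p.2 :=
      Measure.quasiMeasurePreserving_snd.ae hi
    filter_upwards [hi1, hi2] with p hp1 hp2
    obtain ⟨τ, hτ⟩ := exists_strictMono_comp_perm hp1
    obtain ⟨s, hs⟩ := exists_strictMono_comp_perm hp2
    simp_rw [pointCount_eq_occ σ hτ hs]
    exact Fintype.sum_equiv ((Equiv.mulLeft s⁻¹).trans (Equiv.mulRight τ)) _ _ fun ρ => rfl
  have hInt : ∀ ρ : Equiv.Perm (Fin n),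
      Integrable (fun p => F (pointCount σ (p.1, p.2 ∘ ρ))) (Q.prod Q) := by
    intro ρ
    have hm : Measurable fun p : (Fin n → ℝ) × (Fin n → ℝ) => (p.1, p.2 ∘ ρ) :=
      measurable_fst.prodMk (measurable_pi_lambda _ fun i => by
        simp only [Function.comp_apply]; fun_prop)
    exact integrable_of_abs_le (hF.comp ((measurable_pointCount σ).comp hm)) fun _ => hC _
  have h4 := integral_congr_ae h3
  rw [integral_finsetSum _ fun ρ _ => hInt ρ] at h4
  simp only [h2, Finset.sum_const, Finset.card_univ, Fintype.card_perm, Fintype.card_fin,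
    nsmul_eq_mul, integral_const, probReal_univ, one_smul] at h4
  rw [h1, eq_div_iff (by positivity), mul_comm, h4]

lemma integral_map_uniformOfFintype {n : ℕ} (X : Equiv.Perm (Fin n) → ℝ)
    {F : ℝ → ℝ} (hF : Measurable F) :
    ∫ t, F t ∂(Measure.map X (PMF.uniformOfFintype (Equiv.Perm (Fin n))).toMeasure) =
      (∑ π, F (X π)) / n.factorial := by
  have hd : DiscreteMeasurableSpace (Equiv.Perm (Fin n)) := ⟨fun _ => trivial⟩
  rw [integral_map Measurable.of_discrete.aemeasurable hF.aestronglyMeasurable,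
    PMF.integral_eq_sum, Finset.sum_div]
  refine Finset.sum_congr rfl fun π _ => ?_
  simp [PMF.uniformOfFintype_apply, Fintype.card_perm, div_eq_inv_mul]

end RandomPoints

section UniformPoints

/-- Lebesgue measure on the unit interval. -/
noncomputable abbrev unitMeasure : Measure ℝ := volume.restrict (Set.Ioc 0 1)

instance : IsProbabilityMeasure unitMeasure := ⟨by simp⟩

lemma integral_indicator_Ioc_unitMeasure {a b : ℝ} (ha : 0 ≤ a) (hab : a ≤ b) (hb : b ≤ 1)
    (h : ℝ → ℝ) : ∫ t, (Set.Ioc a b).indicator h t ∂unitMeasure = ∫ t in a..b, h t := by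
  rw [integral_indicator measurableSet_Ioc, Measure.restrict_restrict measurableSet_Ioc,
    Set.inter_eq_left.2 (Set.Ioc_subset_Ioc ha hb), intervalIntegral.integral_of_le hab]

lemma integral_infinitePi_fin_succ (ν : Measure ℝ) [IsProbabilityMeasure ν] {n : ℕ}
    {F : (Fin (n + 1) → ℝ) → ℝ} (hF : Measurable F) {C : ℝ} (hC : ∀ v, |F v| ≤ C) :
    ∫ w, F w ∂(Measure.infinitePi fun _ : Fin (n + 1) => ν) =
      ∫ t, ∫ v, F (Fin.cons t v) ∂(Measure.infinitePi fun _ : Fin n => ν) ∂ν := by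
  simp only [Measure.infinitePi_eq_pi]
  have hmp := (measurePreserving_piFinSuccAbove (fun _ : Fin (n + 1) => ν) 0).symm
  rw [← integral_comp_of_measurePreserving hmp hF, integral_prod]
  · refine integral_congr_ae (.of_forall fun t => integral_congr_ae (.of_forall fun v => ?_))
    simp [MeasurableEquiv.piFinSuccAbove, Fin.insertNthEquiv]
  · exact integrable_of_abs_le (hF.comp (MeasurableEquiv.measurable _)) fun _ => hC _

lemma strictMono_cons_cons {n : ℕ} (s t : ℝ) (v : Fin n → ℝ) :
    StrictMono (Fin.cons s (Fin.cons t v : Fin (n + 1) → ℝ) : Fin (n + 2) → ℝ) ↔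
      s < t ∧ StrictMono (Fin.cons t v : Fin (n + 1) → ℝ) := by
  rw [Fin.strictMono_iff_lt_succ, Fin.strictMono_iff_lt_succ, Fin.forall_fin_succ]
  simp

lemma incr_cons_cons {n : ℕ} (s t : ℝ) (v : Fin n → ℝ) :
    incr (Fin.cons s (Fin.cons t v : Fin (n + 1) → ℝ) : Fin (n + 2) → ℝ) =
      (Set.Ioi s).indicator (fun t => incr (Fin.cons t v : Fin (n + 1) → ℝ)) t := by
  by_cases h : s < t <;>
    by_cases h' : StrictMono (Fin.cons t v : Fin (n + 1) → ℝ) <;>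
      simp [incr, strictMono_cons_cons, h, h']

lemma measurable_incr_cons {n : ℕ} (s : ℝ) :
    Measurable fun v : Fin n → ℝ => incr (Fin.cons s v : Fin (n + 1) → ℝ) :=
  measurable_incr.comp (measurable_pi_lambda _ fun i => by
    refine Fin.cases ?_ (fun j => ?_) i
    · simp
    · simpa using measurable_pi_apply j)

/-- The volume of the simplex `s < v 0 < ⋯ < v (n - 1) ≤ 1`. -/
lemma integral_incr_cons (n : ℕ) {s : ℝ} (hs : 0 ≤ s) (hs' : s ≤ 1) :
    ∫ v, incr (Fin.cons s v : Fin (n + 1) → ℝ) ∂(Measure.infinitePi fun _ : Fin n => unitMeasure) =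
      (1 - s) ^ n / n.factorial := by
  induction n generalizing s with
  | zero =>
    have : ∀ v : Fin 1 → ℝ, incr v = 1 := fun v => by
      simp [incr, Subsingleton.strictMono]
    simp [this]
  | succ n ih =>
    rw [integral_infinitePi_fin_succ _ (measurable_incr_cons s) fun v => abs_incr_le _]
    have h : ∀ᵐ t ∂unitMeasure,
        ∫ v, incr (Fin.cons s (Fin.cons t v : Fin (n + 1) → ℝ) : Fin (n + 2) → ℝ)
          ∂(Measure.infinitePi fun _ : Fin n => unitMeasure) =
        (Set.Ioc s 1).indicator (fun t => (1 - t) ^ n / n.factorial) t := by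
      filter_upwards [ae_restrict_mem measurableSet_Ioc] with t ht
      simp only [incr_cons_cons]
      by_cases hst : s < t
      · simp [hst, ht.2, ih ht.1.le ht.2]
      · simp [hst]
    rw [integral_congr_ae h, integral_indicator_Ioc_unitMeasure hs hs' le_rfl,
      intervalIntegral.integral_div,
      intervalIntegral.integral_comp_sub_left (fun t => t ^ n), integral_pow]
    rw [Nat.factorial_succ]
    push_cast
    field_simp
    simp

lemma not_strictMono_cons_update {n : ℕ} {t x : ℝ} (hxt : x ≤ t) (a : Fin n) (v : Fin n → ℝ) :
    ¬ StrictMono (Fin.cons t (Function.update v a x) : Fin (n + 1) → ℝ) := fun h => by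
  have := h (Fin.succ_pos a)
  simp only [Fin.cons_zero, Fin.cons_succ, Function.update_self] at this
  exact absurd this hxt.not_gt

/-- The volume of the slice `v a = x` of the simplex `s < v 0 < ⋯ < v (n - 1) ≤ 1`. -/
lemma integral_incr_cons_update {n : ℕ} (a : Fin n) {s x : ℝ} (hs : 0 ≤ s) (hsx : s < x)
    (hx : x ≤ 1) :
    ∫ v, incr (Fin.cons s (Function.update v a x) : Fin (n + 1) → ℝ)
        ∂(Measure.infinitePi fun _ : Fin n => unitMeasure) =
      ((x - s) ^ (a : ℕ) / (a : ℕ).factorial) *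
        ((1 - x) ^ (n - 1 - a) / (n - 1 - a).factorial) := by
  induction n generalizing s with
  | zero => exact a.elim0
  | succ n ih =>
    rw [integral_infinitePi_fin_succ _
      (F := fun v => incr (Fin.cons s (Function.update v a x) : Fin (n + 2) → ℝ))
      ((measurable_incr_cons s).comp (measurable_update_left)) fun v => abs_incr_le _]
    refine Fin.cases ?_ (fun b => ?_) a
    · simp [Fin.update_cons_zero, incr_cons_cons, hsx,
        integral_incr_cons n (hs.trans hsx.le) hx]
    · have h : ∀ᵐ t ∂unitMeasure,
          ∫ v, incr (Fin.cons s (Function.update (Fin.cons t v : Fin (n + 1) → ℝ) b.succ x) :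
              Fin (n + 2) → ℝ) ∂(Measure.infinitePi fun _ : Fin n => unitMeasure) =
          (Set.Ioc s x).indicator (fun t => ((x - t) ^ (b : ℕ) / (b : ℕ).factorial) *
            ((1 - x) ^ (n - 1 - b) / (n - 1 - b).factorial)) t := by
        have hne : ∀ᵐ t ∂unitMeasure, t ≠ x := compl_mem_ae_iff.2 (measure_singleton x)
        filter_upwards [ae_restrict_mem measurableSet_Ioc, hne] with t ht htx
        simp only [← Fin.cons_update, incr_cons_cons]
        by_cases hst : s < t
        · simp only [Set.indicator_of_mem (Set.mem_Ioi.2 hst)]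
          rcases lt_or_gt_of_ne htx with htx | htx
          · rw [ih b ht.1.le htx, Set.indicator_of_mem (Set.mem_Ioc.2 ⟨hst, htx.le⟩)]
          · rw [Set.indicator_of_notMem fun h => htx.not_ge h.2]
            simp only [incr]
            simp only [Set.indicator_of_notMem (show _ ∉ {v : Fin (n + 1) → ℝ | StrictMono v} from
              not_strictMono_cons_update htx.le b _), integral_zero]
        · simp [hst]
      rw [integral_congr_ae h, integral_indicator_Ioc_unitMeasure hs hsx.le hx,
        intervalIntegral.integral_mul_const, intervalIntegral.integral_div,
        intervalIntegral.integral_comp_sub_left (fun t => t ^ (b : ℕ)), integral_pow]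
      have he : n + 1 - 1 - (b.succ : ℕ) = n - 1 - b := by simp; omega
      rw [he, Fin.val_succ, Nat.factorial_succ]
      push_cast
      field_simp
      simp

lemma incr_cons_zero {n : ℕ} {v : Fin n → ℝ} (hv : ∀ i, 0 < v i) :
    incr (Fin.cons 0 v : Fin (n + 1) → ℝ) = incr v := by
  have : StrictMono (Fin.cons 0 v : Fin (n + 1) → ℝ) ↔ StrictMono v := by
    refine ⟨fun h i j hij => ?_, fun h => ?_⟩
    · simpa using h (Fin.succ_lt_succ_iff.2 hij)
    · rw [Fin.strictMono_iff_lt_succ]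
      cases n with
      | zero => exact fun i => i.elim0
      | succ n =>
        rw [Fin.forall_fin_succ]
        rw [Fin.strictMono_iff_lt_succ] at h
        exact ⟨by simpa using hv 0, by simpa using h⟩
  by_cases h : StrictMono v <;> simp [incr, this, h]

lemma ae_pos_infinitePi_unitMeasure (n : ℕ) :
    ∀ᵐ v ∂(Measure.infinitePi fun _ : Fin n => unitMeasure), ∀ i, 0 < v i := by
  rw [ae_all_iff]
  intro i
  have h : ∀ᵐ t ∂unitMeasure, 0 < t := by
    filter_upwards [ae_restrict_mem measurableSet_Ioc] with t ht using ht.1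
  have hmp := measurePreserving_eval_infinitePi (fun _ : Fin n => unitMeasure) i
  exact hmp.quasiMeasurePreserving.ae h

lemma integral_incr (n : ℕ) :
    ∫ v, incr v ∂(Measure.infinitePi fun _ : Fin n => unitMeasure) = 1 / n.factorial := by
  have h := integral_incr_cons n le_rfl zero_le_one
  rw [sub_zero, one_pow] at h
  rw [← h]
  refine integral_congr_ae ?_
  filter_upwards [ae_pos_infinitePi_unitMeasure n] with v hv using (incr_cons_zero hv).symm

lemma integral_incr_update {n : ℕ} (a : Fin n) {x : ℝ} (hx : 0 < x) (hx' : x ≤ 1) :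
    ∫ v, incr (Function.update v a x) ∂(Measure.infinitePi fun _ : Fin n => unitMeasure) =
      g n (a + 1) x / (n - 1).factorial := by
  have h := integral_incr_cons_update a le_rfl hx hx'
  have ha : (a : ℕ) ≤ n - 1 := by omega
  have he : n - (a + 1) = n - 1 - a := by omega
  have hg : g n (a + 1) x / (n - 1).factorial = ((x - 0) ^ (a : ℕ) / (a : ℕ).factorial) *
        ((1 - x) ^ (n - 1 - a) / (n - 1 - a).factorial) := by
    rw [g, Nat.add_sub_cancel, he, Nat.cast_choose ℝ ha]
    field_simp
    ring
  rw [hg, ← h]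
  refine integral_congr_ae ?_
  filter_upwards [ae_pos_infinitePi_unitMeasure n] with v hv
  refine (incr_cons_zero fun i => ?_).symm
  rw [Function.update_apply]
  split_ifs
  · exact hx
  · exact hv i

lemma kernelMean_patternKernel {k : ℕ} (σ : Equiv.Perm (Fin k)) :
    kernelMean (unitMeasure.prod unitMeasure) (patternKernel σ) = (1 / (k.factorial : ℝ)) ^ 2 := by
  simp only [kernelMean, patternKernel_eq_mul]
  have hm : Measurable fun v : Fin k → ℝ => incr (v ∘ σ.symm) :=
    measurable_incr.comp (measurable_pi_lambda _ fun i => by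
      simp only [Function.comp_apply]; fun_prop)
  have h1 := integral_comp_of_measurePreserving (measurePreserving_coordinates unitMeasure k)
    (φ := fun p => incr p.1 * incr (p.2 ∘ σ.symm))
    ((measurable_incr.comp measurable_fst).mul (hm.comp measurable_snd))
  have h2 := integral_comp_of_measurePreserving
    (measurePreserving_comp_injective unitMeasure σ.symm.injective) measurable_incr
  simp only [Function.comp_def] at h1 h2
  rw [h1, integral_prod_mul (fun v : Fin k → ℝ => incr v)
    (fun v : Fin k → ℝ => incr fun i => v (σ.symm i)), h2, integral_incr, sq]

lemma condMean_patternKernel {k : ℕ} (σ : Equiv.Perm (Fin k)) (a : Fin k) {z : ℝ × ℝ}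
    (hz : z ∈ Set.Ioc (0 : ℝ) 1 ×ˢ Set.Ioc (0 : ℝ) 1) :
    condMean (unitMeasure.prod unitMeasure) (patternKernel σ) a z =
      (1 / ((k - 1).factorial : ℝ) ^ 2) * (g k (a + 1) z.1 * g k (σ a + 1) z.2) := by
  have hu : ∀ (b : Fin k) (t : ℝ), Measurable fun v : Fin k → ℝ => incr (Function.update v b t) :=
    fun b t => measurable_incr.comp measurable_update_left
  have hk : ∀ w : Fin k → ℝ × ℝ, patternKernel σ (Function.update w a z) =
      incr (Function.update (fun i => (w i).1) a z.1) *
        incr (Function.update ((fun i => (w i).2) ∘ σ.symm) (σ a) z.2) := by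
    intro w
    rw [patternKernel_eq_mul]
    congr 2
    · ext i; simp only [Function.update_apply]; split_ifs <;> rfl
    · ext i; simp only [Function.update_apply, Function.comp_apply, Equiv.symm_apply_eq]
      split_ifs <;> rfl
  have hm : Measurable fun v : Fin k → ℝ => incr (Function.update (v ∘ σ.symm) (σ a) z.2) :=
    (hu _ _).comp (measurable_pi_lambda _ fun i => by
      simp only [Function.comp_apply]; fun_prop)
  have h1 := integral_comp_of_measurePreserving (measurePreserving_coordinates unitMeasure k)
    (φ := fun p => incr (Function.update p.1 a z.1) *
      incr (Function.update (p.2 ∘ σ.symm) (σ a) z.2))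
    (((hu _ _).comp measurable_fst).mul (hm.comp measurable_snd))
  have h2 := integral_comp_of_measurePreserving
    (measurePreserving_comp_injective unitMeasure σ.symm.injective) (hu (σ a) z.2)
  simp only [Function.comp_def] at h1 h2 hk
  simp only [condMean, hk]
  rw [h1, integral_prod_mul (fun v : Fin k → ℝ => incr (Function.update v a z.1))
    (fun v : Fin k → ℝ => incr (Function.update (fun i => v (σ.symm i)) (σ a) z.2)), h2,
    integral_incr_update a hz.1.1 hz.1.2, integral_incr_update _ hz.2.1 hz.2.2]
  field_simp

lemma firstProjection_patternKernel {k : ℕ} (hk : 1 ≤ k) (σ : Equiv.Perm (Fin k)) {z : ℝ × ℝ}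
    (hz : z ∈ Set.Ioc (0 : ℝ) 1 ×ˢ Set.Ioc (0 : ℝ) 1) :
    firstProjection (unitMeasure.prod unitMeasure) (patternKernel σ) z = G σ z.1 z.2 := by
  simp only [firstProjection, condMean_patternKernel σ _ hz, kernelMean_patternKernel, G,
    Finset.sum_sub_distrib, ← Finset.mul_sum]
  obtain ⟨k, rfl⟩ := Nat.exists_eq_add_of_le' hk
  simp only [Finset.sum_const, Finset.card_univ, Fintype.card_fin, nsmul_eq_mul,
    Nat.add_sub_cancel, Nat.factorial_succ]
  push_cast
  field_simp

lemma integral_firstProjection_sq {k : ℕ} (hk : 1 ≤ k) (σ : Equiv.Perm (Fin k)) :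
    ∫ z, firstProjection (unitMeasure.prod unitMeasure) (patternKernel σ) z ^ 2
        ∂(unitMeasure.prod unitMeasure) =
      ∫ x in (0 : ℝ)..1, ∫ y in (0 : ℝ)..1, G σ x y ^ 2 := by
  have hμ : unitMeasure.prod unitMeasure =
      (volume.prod volume).restrict (Set.Ioc (0 : ℝ) 1 ×ˢ Set.Ioc (0 : ℝ) 1) :=
    Measure.prod_restrict _ _
  have hG : Continuous fun z : ℝ × ℝ => G σ z.1 z.2 ^ 2 := by
    simp only [G, g]; fun_prop
  have hae : ∀ᵐ z ∂(unitMeasure.prod unitMeasure),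
      firstProjection (unitMeasure.prod unitMeasure) (patternKernel σ) z ^ 2 =
        G σ z.1 z.2 ^ 2 := by
    have : ∀ᵐ z ∂(unitMeasure.prod unitMeasure), z ∈ Set.Ioc (0 : ℝ) 1 ×ˢ Set.Ioc (0 : ℝ) 1 := by
      rw [hμ]; exact ae_restrict_mem (measurableSet_Ioc.prod measurableSet_Ioc)
    filter_upwards [this] with z hz
    rw [firstProjection_patternKernel hk σ hz]
  have hInt : Integrable (fun z : ℝ × ℝ => G σ z.1 z.2 ^ 2) (unitMeasure.prod unitMeasure) := by
    rw [hμ]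
    refine IntegrableOn.mono_set (hG.locallyIntegrable.integrableOn_isCompact
      (isCompact_Icc.prod isCompact_Icc)) (Set.prod_mono Set.Ioc_subset_Icc_self
        Set.Ioc_subset_Icc_self)
  rw [integral_congr_ae hae, integral_prod _ hInt]
  simp only [intervalIntegral.integral_of_le zero_le_one]

end UniformPoints

/-- Central limit theorem for pattern counts: the normalized count
`(X_σ(π_n) − C(n,k)/k!)/n^{k−1/2}` of occurrences of `σ` in a uniformly random `π_n ∈ S_n`
converges in distribution (i.e., weakly: integrals of every bounded continuous function
converge) to the centered Gaussian with variance `Σ_{σ,σ} = ∫₀¹∫₀¹ G_σ(x,y)² dx dy`. -/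
theorem stmt18 (k : ℕ) (hk : 1 ≤ k) (σ : Equiv.Perm (Fin k)) :
    ∀ f : BoundedContinuousFunction ℝ ℝ,
      Tendsto (fun n : ℕ =>
          ∫ t, f t ∂(Measure.map
            (fun π : Equiv.Perm (Fin n) =>
              ((occ σ π : ℝ) - (n.choose k : ℝ) / (k.factorial : ℝ))
                / (n : ℝ) ^ ((k : ℝ) - 1 / 2))
            (PMF.uniformOfFintype (Equiv.Perm (Fin n))).toMeasure))
        atTop
        (nhds (∫ t, f t ∂(gaussianReal 0
          (Real.toNNReal (∫ x in (0:ℝ)..1, ∫ y in (0:ℝ)..1, (G σ x y) ^ 2))))) := by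
  intro f
  set μ := unitMeasure.prod unitMeasure with hμ
  set c : ℕ → ℝ := fun n => n.descFactorial k * kernelMean μ (patternKernel σ) with hc
  have hc' : ∀ n : ℕ, (n.choose k : ℝ) / (k.factorial : ℝ) = c n := fun n => by
    simp only [hc, hμ, kernelMean_patternKernel, Nat.descFactorial_eq_factorial_mul_choose]
    push_cast
    field_simp
  have hF : ∀ n : ℕ, Measurable fun t : ℝ => f ((t - c n) / (n : ℝ) ^ ((k : ℝ) - 1 / 2)) :=
    fun n => f.continuous.measurable.comp (by fun_prop)
  have h := (tendstoInDistribution_injSum μ hk (measurable_patternKernel σ)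
    (abs_patternKernel_le σ)).tendsto
  have h := ProbabilityMeasure.tendsto_iff_forall_integral_tendsto.1 h f
  simp only [ProbabilityMeasure.coe_mk, Measure.map_id] at h
  rw [integral_firstProjection_sq hk σ] at h
  refine h.congr fun n => ?_
  rw [integral_map_uniformOfFintype _ f.continuous.measurable, integral_map]
  · rw [integral_injSum_patternKernel unitMeasure σ (hF n) fun t => f.norm_coe_le_norm _]
    simp only [hc']
  · exact ((measurable_injSum (measurable_patternKernel σ) n).sub_const _).div_const _
      |>.aemeasurable
  · exact f.continuous.aestronglyMeasurable
end

section
/- Let k, ℓ ≥ 1, σ ∈ S_k, and τ ∈ S_ℓ. For each n, let Cov_n(σ,τ) := (1/n!)·∑_{π ∈ S_n} (N_σ(π) − binom(n,k)/k!)(N_τ(π) − binom(n,ℓ)/ℓ!) be the covariance of the pattern counts of σ and τ under the uniform distribution on S_n. Then Cov_n(σ,τ)/n^{k+ℓ−1} → Σ_{σ,τ} as n → ∞, where Σ_{σ,τ} := ∫₀¹∫₀¹ G_σ(x,y)·G_τ(x,y) dx dy. -/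
open Filter

theorem card_filter_lt_and_gt_perm {n : ℕ} (o : Fin n) (V : Finset (Fin n)) :
    ∀ U : Finset (Fin n), o ∉ U → o ∉ V → Disjoint U V →
    ((Finset.univ.filter (fun π : Equiv.Perm (Fin n) =>
        (∀ u ∈ U, π u < π o) ∧ ∀ v ∈ V, π o < π v)).card : ℝ)
      = n.factorial * ∫ x in (0:ℝ)..1, x ^ U.card * (1 - x) ^ V.card := by
  induction V using Finset.induction_on with
  | empty =>
    intro U hU _ _
    set W := insert o U with hW
    let M : Fin n → Finset (Equiv.Perm (Fin n)) := fun w =>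
      Finset.univ.filter (fun π => ∀ u ∈ W, u ≠ w → π u < π w)
    have hM : ∀ w ∈ W, (M w).card = (M o).card := by
      intro w hw
      refine Finset.card_bij' (fun π _ => π * Equiv.swap o w) (fun π _ => π * Equiv.swap o w)
        ?_ ?_ ?_ ?_
      · intro π hπ
        simp only [M, Finset.mem_filter, Finset.mem_univ, true_and, Equiv.Perm.mul_apply,
          Equiv.swap_apply_left] at hπ ⊢
        intro u hu huo
        by_cases huw : u = w
        · subst huw
          rw [Equiv.swap_apply_right]
          exact hπ o (Finset.mem_insert_self _ _) (Ne.symm huo)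
        · rw [Equiv.swap_apply_of_ne_of_ne huo huw]
          exact hπ u hu huw
      · intro π hπ
        simp only [M, Finset.mem_filter, Finset.mem_univ, true_and, Equiv.Perm.mul_apply,
          Equiv.swap_apply_right] at hπ ⊢
        intro u hu huw
        by_cases huo : u = o
        · subst huo
          rw [Equiv.swap_apply_left]
          exact hπ w hw (Ne.symm huw)
        · rw [Equiv.swap_apply_of_ne_of_ne huo huw]
          exact hπ u hu huo
      · intro π _
        simp [mul_assoc]
      · intro π _
        simp [mul_assoc]
    have hsum : ∑ w ∈ W, (M w).card = n.factorial := by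
      rw [← Finset.card_biUnion]
      · have : W.biUnion M = Finset.univ := by
          refine Finset.eq_univ_iff_forall.2 fun π => ?_
          obtain ⟨w, hw, hmax⟩ := Finset.exists_max_image W π ⟨o, Finset.mem_insert_self _ _⟩
          refine Finset.mem_biUnion.2 ⟨w, hw, ?_⟩
          simp only [M, Finset.mem_filter, Finset.mem_univ, true_and]
          intro u hu huw
          exact lt_of_le_of_ne (hmax u hu) fun h => huw (π.injective h)
        rw [this, Finset.card_univ, Fintype.card_perm, Fintype.card_fin]
      · intro w hw w' hw' hne
        refine Finset.disjoint_left.2 fun π h h' => ?_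
        simp only [M, Finset.mem_filter, Finset.mem_univ, true_and] at h h'
        exact lt_asymm (h w' hw' hne.symm) (h' w hw hne)
    rw [Finset.sum_congr rfl hM, Finset.sum_const, smul_eq_mul, hW,
      Finset.card_insert_of_notMem hU] at hsum
    have hMo : M o = Finset.univ.filter (fun π : Equiv.Perm (Fin n) =>
        (∀ u ∈ U, π u < π o) ∧ ∀ v ∈ (∅ : Finset (Fin n)), π o < π v) := by
      ext π
      simp only [M, hW, Finset.mem_filter, Finset.mem_univ, true_and, Finset.mem_insert,
        Finset.notMem_empty, false_imp_iff, implies_true, and_true]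
      constructor
      · exact fun h u hu => h u (Or.inr hu) fun h' => hU (h' ▸ hu)
      · rintro h u (rfl | hu) huo
        · exact absurd rfl huo
        · exact h u hu
    rw [← hMo, ← hsum]
    simp
    field_simp
  | insert d V hd ih =>
    intro U hU hV hUV
    rw [Finset.mem_insert, not_or] at hV
    rw [Finset.disjoint_insert_right] at hUV
    have h1 := ih U hU hV.2 hUV.2
    have h2 := ih (insert d U) (by simp [hV.1, hU]) hV.2
      (Finset.disjoint_insert_left.2 ⟨hd, hUV.2⟩)
    rw [Finset.card_insert_of_notMem hUV.1] at h2
    rw [Finset.card_insert_of_notMem hd]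
    have h3 : (Finset.univ.filter (fun π : Equiv.Perm (Fin n) =>
        (∀ u ∈ U, π u < π o) ∧ ∀ v ∈ V, π o < π v)).card =
        (Finset.univ.filter (fun π : Equiv.Perm (Fin n) =>
        (∀ u ∈ insert d U, π u < π o) ∧ ∀ v ∈ V, π o < π v)).card +
        (Finset.univ.filter (fun π : Equiv.Perm (Fin n) =>
        (∀ u ∈ U, π u < π o) ∧ ∀ v ∈ insert d V, π o < π v)).card := by
      rw [← Finset.card_filter_add_card_filter_not (fun π : Equiv.Perm (Fin n) => π d < π o),
        Finset.filter_filter, Finset.filter_filter]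
      congr 2
      · ext π
        simp only [Finset.mem_filter, Finset.mem_univ, true_and, Finset.forall_mem_insert]
        tauto
      · ext π
        have : ¬ π d < π o ↔ π o < π d := by
          rw [not_lt]
          exact ⟨fun h => lt_of_le_of_ne h fun h' => hV.1 (π.injective h'), le_of_lt⟩
        simp only [Finset.mem_filter, Finset.mem_univ, true_and, Finset.forall_mem_insert, this]
        tauto
    have h4 : (∫ x in (0:ℝ)..1, x ^ U.card * (1 - x) ^ V.card) =
        (∫ x in (0:ℝ)..1, x ^ (U.card + 1) * (1 - x) ^ V.card) +
        ∫ x in (0:ℝ)..1, x ^ U.card * (1 - x) ^ (V.card + 1) := by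
      rw [← intervalIntegral.integral_add]
      · congr 1
        ext x
        ring
      · exact (by fun_prop : Continuous _).intervalIntegrable _ _
      · exact (by fun_prop : Continuous _).intervalIntegrable _ _
    have h5 := congrArg (Nat.cast : ℕ → ℝ) h3
    push_cast at h5
    rw [h1, h2, h4] at h5
    linarith

/-- The entries of `h` are in the same relative order as those of `σ`. -/
def HasPattern {k n : ℕ} (σ : Equiv.Perm (Fin k)) (h : Fin k → Fin n) : Prop :=
  ∀ a b : Fin k, h a < h b ↔ σ a < σ b

instance {k n : ℕ} (σ : Equiv.Perm (Fin k)) (h : Fin k → Fin n) : Decidable (HasPattern σ h) :=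
  inferInstanceAs (Decidable (∀ a b : Fin k, h a < h b ↔ σ a < σ b))

theorem HasPattern.apply_eq_card {k n : ℕ} {σ : Equiv.Perm (Fin k)} {h : Fin k → Fin n}
    (H : HasPattern σ h) (i : Fin k) :
    (σ i : ℕ) = (Finset.univ.filter (fun b => h b < h i)).card := by
  have : (Finset.univ.filter (fun b => h b < h i)).map σ.toEmbedding = Finset.Iio (σ i) := by
    ext c
    simp only [Finset.mem_map, Finset.mem_filter, Finset.mem_univ, true_and, Finset.mem_Iio,
      Equiv.coe_toEmbedding, H _ i]
    exact ⟨fun ⟨b, hb, hc⟩ => hc ▸ hb, fun hc => ⟨σ.symm c, by simpa using hc, by simp⟩⟩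
  rw [← Finset.card_map σ.toEmbedding, this, Fin.card_Iio]

theorem HasPattern.unique {k n : ℕ} {σ τ : Equiv.Perm (Fin k)} {h : Fin k → Fin n}
    (H : HasPattern σ h) (H' : HasPattern τ h) : σ = τ := by
  ext i
  rw [H.apply_eq_card, H'.apply_eq_card]

theorem exists_hasPattern {k n : ℕ} {h : Fin k → Fin n} (hh : Function.Injective h) :
    ∃ σ : Equiv.Perm (Fin k), HasPattern σ h := by
  refine ⟨(Tuple.sort h)⁻¹, fun a b => ?_⟩
  have hm : StrictMono (h ∘ Tuple.sort h) :=
    (Tuple.monotone_sort h).strictMono_of_injective (hh.comp (Tuple.sort h).injective)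
  rw [← hm.lt_iff_lt]
  simp

theorem hasPattern_comp_iff {k n : ℕ} {σ α : Equiv.Perm (Fin k)} {h : Fin k → Fin n} :
    HasPattern (σ * α) (h ∘ α) ↔ HasPattern σ h := by
  constructor
  · intro H a b
    have := H (α.symm a) (α.symm b)
    simpa using this
  · intro H a b
    exact H (α a) (α b)

/-- The number of permutations with pattern `σ` along `f` and pattern `τ` along `f'`. -/
def jointCount {k l n : ℕ} (σ : Equiv.Perm (Fin k)) (τ : Equiv.Perm (Fin l))
    (f : Fin k ↪ Fin n) (f' : Fin l ↪ Fin n) : ℕ :=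
  (Finset.univ.filter (fun π : Equiv.Perm (Fin n) =>
    HasPattern σ (π ∘ f) ∧ HasPattern τ (π ∘ f'))).card

theorem jointCount_comm {k l n : ℕ} (σ : Equiv.Perm (Fin k)) (τ : Equiv.Perm (Fin l))
    (f : Fin k ↪ Fin n) (f' : Fin l ↪ Fin n) :
    jointCount σ τ f f' = jointCount τ σ f' f := by
  simp only [jointCount, and_comm]

theorem jointCount_mul_left {k l n : ℕ} (σ α : Equiv.Perm (Fin k)) (τ : Equiv.Perm (Fin l))
    (f : Fin k ↪ Fin n) (f' : Fin l ↪ Fin n) (hα : ∀ i j, f i = f' j → α i = i) :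
    jointCount (σ * α) τ f f' = jointCount σ τ f f' := by
  set e := α.viaFintypeEmbedding f with he
  have hef : ⇑e ∘ f = f ∘ α := by
    ext a
    simp [he]
  have hef' : ⇑e ∘ f' = f' := by
    funext j
    by_cases hj : f' j ∈ Set.range f
    · obtain ⟨i, hi⟩ := hj
      simp only [Function.comp_apply, ← hi, he, Equiv.Perm.viaFintypeEmbedding_apply_image]
      rw [hα i j hi]
    · exact Equiv.Perm.viaFintypeEmbedding_apply_notMem_range _ _ hj
  unfold jointCount
  refine Finset.card_bij' (fun π _ => π * e⁻¹) (fun π _ => π * e) ?_ ?_ ?_ ?_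
  · intro π hπ
    simp only [Finset.mem_filter, Finset.mem_univ, true_and] at hπ ⊢
    have h1 : (⇑(π * e⁻¹) ∘ f) ∘ α = π ∘ f := by
      rw [Function.comp_assoc, ← hef]
      ext a
      simp
    have h2 : ⇑(π * e⁻¹) ∘ f' = π ∘ f' := by
      conv_lhs => rw [← hef']
      ext a
      simp
    rw [← h1, hasPattern_comp_iff] at hπ
    rwa [h2]
  · intro π hπ
    simp only [Finset.mem_filter, Finset.mem_univ, true_and] at hπ ⊢
    rw [Equiv.Perm.coe_mul, Function.comp_assoc, hef, Function.comp_assoc, hef',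
      ← Function.comp_assoc, hasPattern_comp_iff]
    exact hπ
  · intro π _
    simp
  · intro π _
    simp

theorem jointCount_congr {k l n : ℕ} {σ σ' : Equiv.Perm (Fin k)} {τ τ' : Equiv.Perm (Fin l)}
    {f : Fin k ↪ Fin n} {f' : Fin l ↪ Fin n} (hσ : ∀ i j, f i = f' j → σ i = σ' i)
    (hτ : ∀ i j, f i = f' j → τ j = τ' j) :
    jointCount σ τ f f' = jointCount σ' τ' f f' := by
  have h1 : jointCount σ τ f f' = jointCount σ' τ f f' := by
    rw [← jointCount_mul_left σ' (σ'⁻¹ * σ) τ f f' fun i j h => by simp [hσ i j h],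
      mul_inv_cancel_left]
  have h2 : jointCount τ σ' f' f = jointCount τ' σ' f' f := by
    rw [← jointCount_mul_left τ' (τ'⁻¹ * τ) σ' f' f fun i j h => by simp [hτ j i h.symm],
      mul_inv_cancel_left]
  rw [h1, jointCount_comm, h2, jointCount_comm]

theorem sum_jointCount {k l n : ℕ} (f : Fin k ↪ Fin n) (f' : Fin l ↪ Fin n)
    (S : Finset (Equiv.Perm (Fin k))) (T : Finset (Equiv.Perm (Fin l))) :
    ∑ σ ∈ S, ∑ τ ∈ T, jointCount σ τ f f' =
      (Finset.univ.filter (fun π : Equiv.Perm (Fin n) =>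
        (∃ σ ∈ S, HasPattern σ (π ∘ f)) ∧ ∃ τ ∈ T, HasPattern τ (π ∘ f'))).card := by
  simp only [jointCount]
  rw [← Finset.sum_product', ← Finset.card_biUnion]
  · congr 1
    ext π
    simp only [Finset.mem_biUnion, Finset.mem_product, Finset.mem_filter, Finset.mem_univ,
      true_and, Prod.exists]
    exact ⟨fun ⟨σ, τ, ⟨h1, h2⟩, h3, h4⟩ => ⟨⟨σ, h1, h3⟩, τ, h2, h4⟩,
      fun ⟨⟨σ, h1, h3⟩, τ, h2, h4⟩ => ⟨σ, τ, ⟨h1, h2⟩, h3, h4⟩⟩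
  · intro p _ q _ hpq
    refine Finset.disjoint_left.2 fun π h h' => hpq ?_
    simp only [Finset.mem_filter, Finset.mem_univ, true_and] at h h'
    exact Prod.ext (h.1.unique h'.1) (h.2.unique h'.2)

theorem jointCount_of_disjoint {k l n : ℕ} (σ : Equiv.Perm (Fin k)) (τ : Equiv.Perm (Fin l))
    (f : Fin k ↪ Fin n) (f' : Fin l ↪ Fin n) (hd : ∀ i j, f i ≠ f' j) :
    k.factorial * l.factorial * jointCount σ τ f f' = n.factorial := by
  have h := sum_jointCount f f' Finset.univ Finset.univ
  have hex : ∀ {m : ℕ} (e : Fin m ↪ Fin n) (π : Equiv.Perm (Fin n)),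
      ∃ σ ∈ (Finset.univ : Finset (Equiv.Perm (Fin m))), HasPattern σ (π ∘ e) := fun e π => by
    simpa using exists_hasPattern (π.injective.comp e.injective)
  rw [Finset.filter_true_of_mem fun π _ => ⟨hex f π, hex f' π⟩] at h
  have h2 : ∀ (σ' : Equiv.Perm (Fin k)) (τ' : Equiv.Perm (Fin l)),
      jointCount σ' τ' f f' = jointCount σ τ f f' := fun σ' τ' =>
    jointCount_congr (fun i j h => absurd h (hd i j)) fun i j h => absurd h (hd i j)
  simpa [h2, Finset.card_univ, Fintype.card_perm, mul_assoc] using h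

theorem card_perm_apply_eq {k : ℕ} (i a : Fin k) :
    (Finset.univ.filter (fun σ : Equiv.Perm (Fin k) => σ i = a)).card = (k - 1).factorial := by
  have h := Finset.card_eq_sum_card_fiberwise (s := (Finset.univ : Finset (Equiv.Perm (Fin k))))
    (t := Finset.univ) (f := fun σ => σ i) (fun _ _ => Finset.mem_coe.2 (Finset.mem_univ _))
  have h' : ∀ b : Fin k, (Finset.univ.filter (fun σ : Equiv.Perm (Fin k) => σ i = b)).card =
      (Finset.univ.filter (fun σ : Equiv.Perm (Fin k) => σ i = a)).card := by
    intro b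
    refine Finset.card_bij' (fun σ _ => Equiv.swap a b * σ) (fun σ _ => Equiv.swap a b * σ)
      ?_ ?_ ?_ ?_ <;> intro σ hσ <;> simp_all [← mul_assoc]
  have hk : 0 < k := i.pos
  rw [Finset.sum_congr rfl fun b _ => h' b, Finset.sum_const, Finset.card_univ, Finset.card_univ,
    Fintype.card_perm, Fintype.card_fin, smul_eq_mul, ← Nat.mul_factorial_pred hk.ne'] at h
  exact (Nat.eq_of_mul_eq_mul_left hk h).symm

theorem card_embedding_apply_eq {l n : ℕ} (j : Fin l) (v : Fin n) :
    n * (Finset.univ.filter (fun f : Fin l ↪ Fin n => f j = v)).card = n.descFactorial l := by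
  have h := Finset.card_eq_sum_card_fiberwise (s := (Finset.univ : Finset (Fin l ↪ Fin n)))
    (t := Finset.univ) (f := fun f => f j) (fun _ _ => Finset.mem_coe.2 (Finset.mem_univ _))
  have h' : ∀ b : Fin n, (Finset.univ.filter (fun f : Fin l ↪ Fin n => f j = b)).card =
      (Finset.univ.filter (fun f : Fin l ↪ Fin n => f j = v)).card := by
    intro b
    refine Finset.card_bij' (fun f _ => f.trans (Equiv.swap v b).toEmbedding)
      (fun f _ => f.trans (Equiv.swap v b).toEmbedding) ?_ ?_ ?_ ?_ <;> intro f hf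
    · simp_all
    · simp_all
    · ext; simp
    · ext; simp
  rw [Finset.sum_congr rfl fun b _ => h' b, Finset.sum_const, Finset.card_univ, Finset.card_univ,
    Fintype.card_embedding_eq, Fintype.card_fin, Fintype.card_fin, smul_eq_mul] at h
  exact h.symm

theorem filter_lt_eq_iff {k n : ℕ} {h : Fin k → Fin n} (hh : Function.Injective h) (i : Fin k)
    {C : Finset (Fin k)} (hC : i ∉ C) :
    Finset.univ.filter (fun b => h b < h i) = C ↔
      (∀ b ∈ C, h b < h i) ∧ ∀ b ∈ Finset.univ.erase i \ C, h i < h b := by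
  constructor
  · rintro rfl
    refine ⟨fun b hb => (Finset.mem_filter.1 hb).2, fun b hb => ?_⟩
    simp only [Finset.mem_sdiff, Finset.mem_erase, Finset.mem_univ, and_true, Finset.mem_filter,
      true_and, not_lt] at hb
    exact lt_of_le_of_ne hb.2 fun h' => hb.1 (hh h'.symm)
  · rintro ⟨h1, h2⟩
    ext b
    simp only [Finset.mem_filter, Finset.mem_univ, true_and]
    refine ⟨fun hb => ?_, h1 b⟩
    by_contra hbC
    have hbi : b ≠ i := by
      rintro rfl
      exact lt_irrefl _ hb
    exact lt_asymm hb (h2 b (by simp [hbi, hbC]))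

theorem exists_hasPattern_apply_iff {k n : ℕ} {h : Fin k → Fin n} (hh : Function.Injective h)
    (i a : Fin k) :
    (∃ σ ∈ Finset.univ.filter (fun σ : Equiv.Perm (Fin k) => σ i = a), HasPattern σ h) ↔
      (Finset.univ.filter (fun b => h b < h i)).card = a := by
  constructor
  · rintro ⟨σ, hσ, H⟩
    rw [← H.apply_eq_card, (Finset.mem_filter.1 hσ).2]
  · intro hc
    obtain ⟨σ, H⟩ := exists_hasPattern hh
    refine ⟨σ, Finset.mem_filter.2 ⟨Finset.mem_univ _, Fin.ext ?_⟩, H⟩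
    rw [H.apply_eq_card, hc]

/-- The `L²` pairing of `g_{k,i+1}` and `g_{l,j+1}`. -/
noncomputable def gInner (k l i j : ℕ) : ℝ :=
  ∫ x in (0:ℝ)..1, g k (i + 1) x * g l (j + 1) x

theorem jointCount_of_inter {k l n : ℕ} (σ : Equiv.Perm (Fin k)) (τ : Equiv.Perm (Fin l))
    (f : Fin k ↪ Fin n) (f' : Fin l ↪ Fin n) (i : Fin k) (j : Fin l) (hij : f i = f' j)
    (huniq : ∀ a b, f a = f' b → a = i ∧ b = j) :
    ((k - 1).factorial * (l - 1).factorial * jointCount σ τ f f' : ℝ) =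
      n.factorial * gInner k l (σ i) (τ j) := by
  set S := Finset.univ.filter (fun σ' : Equiv.Perm (Fin k) => σ' i = σ i) with hS
  set T := Finset.univ.filter (fun τ' : Equiv.Perm (Fin l) => τ' j = τ j) with hT
  have h1 : ∑ σ' ∈ S, ∑ τ' ∈ T, jointCount σ' τ' f f' =
      (k - 1).factorial * ((l - 1).factorial * jointCount σ τ f f') := by
    rw [Finset.sum_congr rfl fun σ' hσ' => Finset.sum_congr rfl fun τ' hτ' =>
      jointCount_congr (σ' := σ) (τ' := τ) (fun a b h => ?_) fun a b h => ?_]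
    · rw [Finset.sum_const, Finset.sum_const, card_perm_apply_eq, card_perm_apply_eq, smul_eq_mul,
        smul_eq_mul]
    · rw [(huniq a b h).1]
      exact (Finset.mem_filter.1 hσ').2
    · rw [(huniq a b h).2]
      exact (Finset.mem_filter.1 hτ').2
  rw [sum_jointCount] at h1
  set Q := Finset.univ.filter (fun π : Equiv.Perm (Fin n) =>
        (∃ σ ∈ S, HasPattern σ (π ∘ f)) ∧ ∃ τ ∈ T, HasPattern τ (π ∘ f')) with hQ
  set X := Finset.powersetCard (σ i) (Finset.univ.erase i) ×ˢ
    Finset.powersetCard (τ j) (Finset.univ.erase j) with hX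
  have hmaps : Set.MapsTo (fun π : Equiv.Perm (Fin n) =>
      (Finset.univ.filter (fun b => (π ∘ f) b < (π ∘ f) i),
        Finset.univ.filter (fun b => (π ∘ f') b < (π ∘ f') j))) (Q : Set (Equiv.Perm (Fin n)))
        (X : Set (Finset (Fin k) × Finset (Fin l))) := by
    intro π hπ
    have hπ' := (Finset.mem_filter.1 (Finset.mem_coe.1 hπ)).2
    rw [exists_hasPattern_apply_iff (π.injective.comp f.injective),
      exists_hasPattern_apply_iff (π.injective.comp f'.injective)] at hπ'
    refine Finset.mem_coe.2 (Finset.mem_product.2 ⟨Finset.mem_powersetCard.2 ⟨?_, hπ'.1⟩,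
      Finset.mem_powersetCard.2 ⟨?_, hπ'.2⟩⟩)
    · intro b hb
      refine Finset.mem_erase.2 ⟨?_, Finset.mem_univ _⟩
      rintro rfl
      exact lt_irrefl _ (Finset.mem_filter.1 hb).2
    · intro b hb
      refine Finset.mem_erase.2 ⟨?_, Finset.mem_univ _⟩
      rintro rfl
      exact lt_irrefl _ (Finset.mem_filter.1 hb).2
  have h2 := Finset.card_eq_sum_card_fiberwise hmaps
  set I : ℝ := ∫ x in (0:ℝ)..1, x ^ ((σ i : ℕ) + τ j) *
    (1 - x) ^ ((k - ((σ i : ℕ) + 1)) + (l - ((τ j : ℕ) + 1))) with hI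
  have h3 : ∀ p ∈ X, ((Q.filter (fun π : Equiv.Perm (Fin n) =>
      (Finset.univ.filter (fun b => (π ∘ f) b < (π ∘ f) i),
        Finset.univ.filter (fun b => (π ∘ f') b < (π ∘ f') j)) = p)).card : ℝ) =
        n.factorial * I := by
    rintro ⟨C, C'⟩ hp
    obtain ⟨hC, hC'⟩ := Finset.mem_product.1 hp
    obtain ⟨hC, hCc⟩ := Finset.mem_powersetCard.1 hC
    obtain ⟨hC', hCc'⟩ := Finset.mem_powersetCard.1 hC'
    simp only at hC hCc hC' hCc'
    have hiC : i ∉ C := fun h => (Finset.mem_erase.1 (hC h)).1 rfl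
    have hjC : j ∉ C' := fun h => (Finset.mem_erase.1 (hC' h)).1 rfl
    set U := C.map f ∪ C'.map f' with hU
    set V := (Finset.univ.erase i \ C).map f ∪ (Finset.univ.erase j \ C').map f' with hV
    have hd1 : ∀ (A : Finset (Fin k)) (A' : Finset (Fin l)), i ∉ A →
        Disjoint (A.map f) (A'.map f') := by
      intro A A' hA
      refine Finset.disjoint_left.2 fun x hx hx' => ?_
      obtain ⟨a, ha, rfl⟩ := Finset.mem_map.1 hx
      obtain ⟨b, hb, hab⟩ := Finset.mem_map.1 hx'
      exact hA ((huniq a b hab.symm).1 ▸ ha)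
    have hUc : U.card = σ i + τ j := by
      rw [hU, Finset.card_union_of_disjoint (hd1 _ _ hiC), Finset.card_map, Finset.card_map, hCc,
        hCc']
    have hVc : V.card = (k - ((σ i : ℕ) + 1)) + (l - ((τ j : ℕ) + 1)) := by
      rw [hV, Finset.card_union_of_disjoint (hd1 _ _ (by simp)), Finset.card_map, Finset.card_map,
        Finset.card_sdiff_of_subset hC, Finset.card_sdiff_of_subset hC', hCc, hCc',
        Finset.card_erase_of_mem (Finset.mem_univ _), Finset.card_erase_of_mem (Finset.mem_univ _),
        Finset.card_univ, Finset.card_univ, Fintype.card_fin, Fintype.card_fin]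
      omega
    have hoU : f i ∉ U := by
      rw [hU, Finset.mem_union, not_or, Finset.mem_map', hij, Finset.mem_map']
      exact ⟨hiC, hjC⟩
    have hoV : f i ∉ V := by
      rw [hV, Finset.mem_union, not_or, Finset.mem_map', hij, Finset.mem_map']
      exact ⟨by simp, by simp⟩
    have hUV : Disjoint U V := by
      rw [hU, hV, Finset.disjoint_union_left, Finset.disjoint_union_right,
        Finset.disjoint_union_right, Finset.disjoint_map, Finset.disjoint_map]
      exact ⟨⟨Finset.disjoint_sdiff, hd1 _ _ hiC⟩, (hd1 _ _ (by simp)).symm,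
        Finset.disjoint_sdiff⟩
    rw [hI, ← hUc, ← hVc, ← card_filter_lt_and_gt_perm (f i) V U hoU hoV hUV]
    congr 2
    ext π
    have hf := π.injective.comp f.injective
    have hf' := π.injective.comp f'.injective
    rw [Finset.mem_filter, Prod.mk.injEq, hQ, Finset.mem_filter,
      exists_hasPattern_apply_iff hf, exists_hasPattern_apply_iff hf', Finset.mem_filter]
    have e : ((Finset.univ.filter (fun b => (π ∘ f) b < (π ∘ f) i)) = C ∧
        Finset.univ.filter (fun b => (π ∘ f') b < (π ∘ f') j) = C') ↔
        ((∀ u ∈ U, π u < π (f i)) ∧ ∀ v ∈ V, π (f i) < π v) := by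
      rw [filter_lt_eq_iff hf i hiC, filter_lt_eq_iff hf' j hjC, hU, hV]
      simp only [Finset.forall_mem_union, Finset.forall_mem_map, Function.comp_apply]
      rw [← hij]
      tauto
    rw [← e]
    constructor
    · rintro ⟨_, h⟩
      exact ⟨Finset.mem_univ _, h⟩
    · rintro ⟨_, h⟩
      exact ⟨⟨Finset.mem_univ _, by rw [h.1, hCc], by rw [h.2, hCc']⟩, h⟩
  have h4 := congrArg (Nat.cast : ℕ → ℝ) (h1.symm.trans h2)
  push_cast at h4
  rw [Finset.sum_congr rfl h3, Finset.sum_const, hX, Finset.card_product,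
    Finset.card_powersetCard, Finset.card_powersetCard,
    Finset.card_erase_of_mem (Finset.mem_univ _), Finset.card_erase_of_mem (Finset.mem_univ _),
    Finset.card_univ, Finset.card_univ, Fintype.card_fin, Fintype.card_fin, nsmul_eq_mul] at h4
  rw [mul_assoc, h4]
  have h5 : gInner k l (σ i) (τ j) =
      ((k - 1).choose (σ i) : ℝ) * ((l - 1).choose (τ j) : ℝ) * I := by
    rw [gInner, hI, ← intervalIntegral.integral_const_mul]
    congr 1
    ext x
    simp only [g, Nat.add_sub_cancel]
    ring
  rw [h5]
  push_cast
  ring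

@[fun_prop]
theorem continuous_g (k i : ℕ) : Continuous (g k i) := by
  unfold g
  fun_prop

theorem integral_g {k : ℕ} (i : Fin k) : ∫ x in (0:ℝ)..1, g k ((i : ℕ) + 1) x = 1 / k := by
  have hk : 0 < k := i.pos
  let f : Fin k ↪ Fin k := Function.Embedding.refl _
  let f' : Fin 1 ↪ Fin k := ⟨fun _ => i, fun a b _ => Subsingleton.elim a b⟩
  let f₀ : Fin 0 ↪ Fin k := ⟨fun a => a.elim0, fun a => a.elim0⟩
  have h1 := jointCount_of_inter (1 : Equiv.Perm (Fin k)) (1 : Equiv.Perm (Fin 1)) f f' i 0 rfl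
    fun a b h => ⟨h, Subsingleton.elim _ _⟩
  have h2 := jointCount_of_disjoint (1 : Equiv.Perm (Fin k)) (1 : Equiv.Perm (Fin 0)) f f₀
    fun a b => b.elim0
  have h3 : jointCount (1 : Equiv.Perm (Fin k)) (1 : Equiv.Perm (Fin 1)) f f' =
      jointCount (1 : Equiv.Perm (Fin k)) (1 : Equiv.Perm (Fin 0)) f f₀ := by
    unfold jointCount
    congr 1
    ext π
    simp only [Finset.mem_filter, Finset.mem_univ, true_and]
    refine and_congr_right fun _ => ⟨fun _ a => a.elim0, fun _ a b => ?_⟩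
    rw [Subsingleton.elim a b]
    simp
  have h4 : gInner k 1 i 0 = ∫ x in (0:ℝ)..1, g k ((i : ℕ) + 1) x := by
    simp [gInner, g]
  have h5 : jointCount (1 : Equiv.Perm (Fin k)) (1 : Equiv.Perm (Fin 0)) f f₀ = 1 := by
    have hpos : 0 < k.factorial := k.factorial_pos
    simpa [hpos.ne'] using h2
  rw [← h4]
  rw [h3, h5, ← Nat.mul_factorial_pred hk.ne'] at h1
  have hpos : ((k - 1).factorial : ℝ) ≠ 0 := by positivity
  have hk' : (k : ℝ) ≠ 0 := by positivity
  simp only [Equiv.Perm.coe_one, id, Fin.val_zero] at h1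
  push_cast at h1
  simp at h1
  field_simp
  have : ((k - 1).factorial : ℝ) * 1 = (k - 1).factorial * (k * gInner k 1 i 0) := by linarith
  linarith [mul_left_cancel₀ hpos this]

theorem integral_G_mul_G {k l : ℕ} (hk : 1 ≤ k) (hl : 1 ≤ l)
    (σ : Equiv.Perm (Fin k)) (τ : Equiv.Perm (Fin l)) :
    ∫ x in (0:ℝ)..1, ∫ y in (0:ℝ)..1, G σ x y * G τ x y =
      ∑ i : Fin k, ∑ j : Fin l,
        (gInner k l i j / ((k - 1).factorial * (l - 1).factorial) *
          (gInner k l (σ i) (τ j) / ((k - 1).factorial * (l - 1).factorial)) -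
          (1 / (k.factorial * l.factorial : ℝ)) ^ 2) := by
  set K : ℝ := 1 / (((k - 1).factorial : ℝ) ^ 2 * ((l - 1).factorial : ℝ) ^ 2) with hK
  have hII : ∀ {h : ℝ → ℝ}, Continuous h → IntervalIntegrable h MeasureTheory.volume 0 1 :=
    fun h => h.intervalIntegrable _ _
  have hexp : ∀ x y, G σ x y * G τ x y = K * (
      ∑ i : Fin k, ∑ j : Fin l, g k (i + 1) x * g l (j + 1) x *
        (g k (σ i + 1) y * g l (τ j + 1) y)
      - (1 / (l : ℝ)) * ∑ i : Fin k, g k (i + 1) x * g k (σ i + 1) y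
      - (1 / (k : ℝ)) * ∑ j : Fin l, g l (j + 1) x * g l (τ j + 1) y
      + 1 / (k : ℝ) * (1 / l)) := by
    intro x y
    have : ∑ i : Fin k, ∑ j : Fin l, g k (i + 1) x * g l (j + 1) x *
        (g k (σ i + 1) y * g l (τ j + 1) y) =
        (∑ i : Fin k, g k (i + 1) x * g k (σ i + 1) y) *
          ∑ j : Fin l, g l (j + 1) x * g l (τ j + 1) y := by
      rw [Finset.sum_mul_sum]
      refine Finset.sum_congr rfl fun i _ => Finset.sum_congr rfl fun j _ => ?_
      ring
    rw [this, hK]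
    simp only [G]
    field_simp
    ring
  have hy : ∀ x, ∫ y in (0:ℝ)..1, G σ x y * G τ x y = K * (
      ∑ i : Fin k, ∑ j : Fin l, g k (i + 1) x * g l (j + 1) x * gInner k l (σ i) (τ j)
      - (1 / (l : ℝ)) * ∑ i : Fin k, g k (i + 1) x * (1 / k)
      - (1 / (k : ℝ)) * ∑ j : Fin l, g l (j + 1) x * (1 / l)
      + 1 / (k : ℝ) * (1 / l)) := by
    intro x
    simp only [hexp]
    rw [intervalIntegral.integral_const_mul, intervalIntegral.integral_add,
      intervalIntegral.integral_sub, intervalIntegral.integral_sub,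
      intervalIntegral.integral_const_mul, intervalIntegral.integral_const_mul,
      intervalIntegral.integral_finsetSum, intervalIntegral.integral_finsetSum,
      intervalIntegral.integral_finsetSum]
    · congr 4
      · refine Finset.sum_congr rfl fun i _ => ?_
        rw [intervalIntegral.integral_finsetSum]
        · refine Finset.sum_congr rfl fun j _ => ?_
          rw [intervalIntegral.integral_const_mul, gInner]
        · exact fun j _ => hII (by fun_prop)
      · congr 1
        refine Finset.sum_congr rfl fun i _ => ?_
        rw [intervalIntegral.integral_const_mul, integral_g]
      · refine Finset.sum_congr rfl fun i _ => ?_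
        rw [intervalIntegral.integral_const_mul, integral_g]
      · simp
    all_goals first | exact hII (by fun_prop) | exact fun j _ => hII (by fun_prop)
  simp only [hy]
  rw [intervalIntegral.integral_const_mul, intervalIntegral.integral_add,
      intervalIntegral.integral_sub, intervalIntegral.integral_sub,
      intervalIntegral.integral_const_mul, intervalIntegral.integral_const_mul,
      intervalIntegral.integral_finsetSum, intervalIntegral.integral_finsetSum,
      intervalIntegral.integral_finsetSum]
  · have e1 : ∀ i : Fin k, ∫ x in (0:ℝ)..1, ∑ j : Fin l,
        g k (i + 1) x * g l (j + 1) x * gInner k l (σ i) (τ j) =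
        ∑ j : Fin l, gInner k l i j * gInner k l (σ i) (τ j) := by
      intro i
      rw [intervalIntegral.integral_finsetSum]
      · refine Finset.sum_congr rfl fun j _ => ?_
        rw [intervalIntegral.integral_mul_const, ← gInner]
      · exact fun j _ => hII (by fun_prop)
    have hk' : (k : ℝ) ≠ 0 := by positivity
    have hl' : (l : ℝ) ≠ 0 := by positivity
    simp only [e1, intervalIntegral.integral_mul_const, integral_g, Finset.sum_const,
      Finset.card_univ, Fintype.card_fin, nsmul_eq_mul, intervalIntegral.integral_const,
      Finset.sum_sub_distrib]
    rw [← Nat.mul_factorial_pred (by omega : k ≠ 0), ← Nat.mul_factorial_pred (by omega : l ≠ 0)]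
    have e2 : ∑ i : Fin k, ∑ j : Fin l, gInner k l i j / ((k - 1).factorial * (l - 1).factorial) *
          (gInner k l (σ i) (τ j) / ((k - 1).factorial * (l - 1).factorial)) =
        K * ∑ i : Fin k, ∑ j : Fin l, gInner k l i j * gInner k l (σ i) (τ j) := by
      simp only [Finset.mul_sum]
      refine Finset.sum_congr rfl fun i _ => Finset.sum_congr rfl fun j _ => ?_
      rw [hK]
      field_simp
    rw [e2, hK]
    push_cast
    simp only [sub_zero, one_smul]
    field_simp
    ring
  all_goals first | exact hII (by fun_prop) | exact fun j _ => hII (by fun_prop)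

theorem card_embedding_apply_eq_and_apply_eq_le {l n : ℕ} {j j' : Fin l} (hj : j ≠ j')
    (u v : Fin n) :
    (Finset.univ.filter (fun f : Fin l ↪ Fin n => f j = u ∧ f j' = v)).card * n ^ 2 ≤ n ^ l := by
  have h : (Finset.univ.filter (fun f : Fin l ↪ Fin n => f j = u ∧ f j' = v) ×ˢ
      (Finset.univ : Finset (Fin n × Fin n))).card ≤
      (Finset.univ : Finset (Fin l → Fin n)).card := by
    refine Finset.card_le_card_of_injOn
      (fun p => Function.update (Function.update p.1 j p.2.1) j' p.2.2)
      (fun _ _ => Finset.mem_coe.2 (Finset.mem_univ _)) ?_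
    rintro ⟨f, x, y⟩ hp ⟨f', x', y'⟩ hp' h
    simp only [Finset.coe_product, Set.mem_prod, Finset.mem_coe, Finset.mem_filter,
      Finset.mem_univ, true_and, and_true] at hp hp' h
    have hx : x = x' := by simpa [hj] using congrFun h j
    have hy : y = y' := by simpa using congrFun h j'
    have hf : f = f' := by
      ext m
      by_cases h1 : m = j
      · rw [h1, hp.1, hp'.1]
      by_cases h2 : m = j'
      · rw [h2, hp.2, hp'.2]
      have := congrFun h m
      rw [Function.update_of_ne h2, Function.update_of_ne h1, Function.update_of_ne h2,
        Function.update_of_ne h1] at this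
      rw [this]
    rw [hx, hy, hf]
  simpa [Finset.card_product, Finset.card_univ, sq] using h

theorem sum_sum_embedding_apply_eq {k l n : ℕ} (i : Fin k) (j : Fin l) :
    (n : ℝ) * ∑ f : Fin k ↪ Fin n, ∑ f' : Fin l ↪ Fin n, (if f i = f' j then 1 else 0 : ℝ) =
      n.descFactorial k * n.descFactorial l := by
  have h : ∀ f : Fin k ↪ Fin n, (n : ℝ) * ∑ f' : Fin l ↪ Fin n,
      (if f i = f' j then 1 else 0 : ℝ) = n.descFactorial l := by
    intro f
    rw [← card_embedding_apply_eq j (f i), Finset.sum_boole]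
    push_cast
    simp only [eq_comm]
  rw [Finset.mul_sum, Finset.sum_congr rfl fun f _ => h f, Finset.sum_const, Finset.card_univ,
    Fintype.card_embedding_eq, Fintype.card_fin, Fintype.card_fin, nsmul_eq_mul]

/-- Two embeddings meet at both `(i, j)` and `(i', j')`, two positions in different rows and
columns. -/
def MeetsTwice {k l n : ℕ} (f : Fin k ↪ Fin n) (f' : Fin l ↪ Fin n)
    (p : (Fin k × Fin k) × Fin l × Fin l) : Prop :=
  p.2.1 ≠ p.2.2 ∧ f' p.2.1 = f p.1.1 ∧ f' p.2.2 = f p.1.2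

instance {k l n : ℕ} (f : Fin k ↪ Fin n) (f' : Fin l ↪ Fin n)
    (p : (Fin k × Fin k) × Fin l × Fin l) : Decidable (MeetsTwice f f' p) :=
  inferInstanceAs (Decidable (_ ∧ _ ∧ _))

theorem sum_sum_meetsTwice_le {k l n : ℕ} (p : (Fin k × Fin k) × Fin l × Fin l) :
    (∑ f : Fin k ↪ Fin n, ∑ f' : Fin l ↪ Fin n, (if MeetsTwice f f' p then 1 else 0 : ℝ)) *
      n ^ 2 ≤ n ^ (k + l) := by
  have h : ∀ f : Fin k ↪ Fin n, (∑ f' : Fin l ↪ Fin n,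
      (if MeetsTwice f f' p then 1 else 0 : ℝ)) * n ^ 2 ≤ n ^ l := by
    intro f
    rw [Finset.sum_boole]
    by_cases hp : p.2.1 = p.2.2
    · simp [MeetsTwice, hp]
    · simp only [MeetsTwice, ne_eq, hp, not_false_eq_true, true_and]
      exact_mod_cast card_embedding_apply_eq_and_apply_eq_le hp (f p.1.1) (f p.1.2)
  rw [Finset.sum_mul]
  refine (Finset.sum_le_sum fun f _ => h f).trans ?_
  rw [Finset.sum_const, Finset.card_univ, Fintype.card_embedding_eq, Fintype.card_fin,
    Fintype.card_fin, nsmul_eq_mul, pow_add]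
  gcongr
  exact_mod_cast Nat.descFactorial_le_pow n k

/-- The probability that a uniform permutation has pattern `σ` along `f` and `τ` along `f'`. -/
noncomputable def jointProb {k l n : ℕ} (σ : Equiv.Perm (Fin k)) (τ : Equiv.Perm (Fin l))
    (f : Fin k ↪ Fin n) (f' : Fin l ↪ Fin n) : ℝ :=
  jointCount σ τ f f' / n.factorial

theorem jointProb_nonneg {k l n : ℕ} (σ : Equiv.Perm (Fin k)) (τ : Equiv.Perm (Fin l))
    (f : Fin k ↪ Fin n) (f' : Fin l ↪ Fin n) : 0 ≤ jointProb σ τ f f' := by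
  unfold jointProb
  positivity

theorem jointProb_le_one {k l n : ℕ} (σ : Equiv.Perm (Fin k)) (τ : Equiv.Perm (Fin l))
    (f : Fin k ↪ Fin n) (f' : Fin l ↪ Fin n) : jointProb σ τ f f' ≤ 1 := by
  refine div_le_one_of_le₀ ?_ (by positivity)
  have h := Finset.card_filter_le (Finset.univ : Finset (Equiv.Perm (Fin n)))
    (fun π => HasPattern σ (π ∘ f) ∧ HasPattern τ (π ∘ f'))
  rw [Finset.card_univ, Fintype.card_perm, Fintype.card_fin] at h
  exact_mod_cast h

theorem jointProb_of_disjoint {k l n : ℕ} (σ : Equiv.Perm (Fin k)) (τ : Equiv.Perm (Fin l))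
    (f : Fin k ↪ Fin n) (f' : Fin l ↪ Fin n) (hd : ∀ i j, f i ≠ f' j) :
    jointProb σ τ f f' = 1 / (k.factorial * l.factorial) := by
  rw [jointProb, div_eq_div_iff (by positivity) (by positivity),
    ← jointCount_of_disjoint σ τ f f' hd]
  push_cast
  ring

theorem jointProb_of_inter {k l n : ℕ} (σ : Equiv.Perm (Fin k)) (τ : Equiv.Perm (Fin l))
    (f : Fin k ↪ Fin n) (f' : Fin l ↪ Fin n) (i : Fin k) (j : Fin l) (hij : f i = f' j)
    (huniq : ∀ a b, f a = f' b → a = i ∧ b = j) :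
    jointProb σ τ f f' =
      gInner k l (σ i) (τ j) / ((k - 1).factorial * (l - 1).factorial) := by
  rw [jointProb, div_eq_div_iff (by positivity) (by positivity)]
  linarith [jointCount_of_inter σ τ f f' i j hij huniq]

/-- The covariance of the occurrence indicators of `σ` at `f` and of `τ` at `f'`. -/
noncomputable def indicatorCov {k l n : ℕ} (σ : Equiv.Perm (Fin k)) (τ : Equiv.Perm (Fin l))
    (f : Fin k ↪ Fin n) (f' : Fin l ↪ Fin n) : ℝ :=
  jointProb 1 1 f f' * jointProb σ τ f f' - (1 / (k.factorial * l.factorial : ℝ)) ^ 2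

/-- The value of `indicatorCov` when `f` and `f'` meet exactly at `f i = f' j`. -/
noncomputable def meetCov {k l : ℕ} (σ : Equiv.Perm (Fin k)) (τ : Equiv.Perm (Fin l))
    (i : Fin k) (j : Fin l) : ℝ :=
  gInner k l i j / ((k - 1).factorial * (l - 1).factorial) *
    (gInner k l (σ i) (τ j) / ((k - 1).factorial * (l - 1).factorial)) -
      (1 / (k.factorial * l.factorial : ℝ)) ^ 2

theorem abs_indicatorCov_le_one {k l n : ℕ} (σ : Equiv.Perm (Fin k)) (τ : Equiv.Perm (Fin l))
    (f : Fin k ↪ Fin n) (f' : Fin l ↪ Fin n) : |indicatorCov σ τ f f'| ≤ 1 := by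
  have h1 := mul_nonneg (jointProb_nonneg 1 1 f f') (jointProb_nonneg σ τ f f')
  have h2 := mul_le_one₀ (jointProb_le_one 1 1 f f') (jointProb_nonneg σ τ f f')
    (jointProb_le_one σ τ f f')
  have h3 : (1 / (k.factorial * l.factorial : ℝ)) ^ 2 ≤ 1 := by
    refine pow_le_one₀ (by positivity) (div_le_one_of_le₀ ?_ (by positivity))
    exact_mod_cast Nat.mul_pos k.factorial_pos l.factorial_pos
  have h4 : 0 ≤ (1 / (k.factorial * l.factorial : ℝ)) ^ 2 := by positivity
  rw [indicatorCov, abs_le]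
  constructor <;> linarith

theorem abs_indicatorCov_sub_le {k l n : ℕ} (σ : Equiv.Perm (Fin k)) (τ : Equiv.Perm (Fin l))
    (f : Fin k ↪ Fin n) (f' : Fin l ↪ Fin n) :
    |indicatorCov σ τ f f' -
        ∑ i : Fin k, ∑ j : Fin l, meetCov σ τ i j * (if f i = f' j then 1 else 0)| ≤
      (1 + ∑ i : Fin k, ∑ j : Fin l, |meetCov σ τ i j|) *
        ∑ p : (Fin k × Fin k) × Fin l × Fin l, (if MeetsTwice f f' p then 1 else 0) := by
  have hB : 0 ≤ 1 + ∑ i : Fin k, ∑ j : Fin l, |meetCov σ τ i j| := by positivity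
  by_cases hp : ∃ p, MeetsTwice f f' p
  · obtain ⟨p, hp⟩ := hp
    have h1 : (1 : ℝ) ≤ ∑ p : (Fin k × Fin k) × Fin l × Fin l,
        (if MeetsTwice f f' p then 1 else 0) := by
      refine le_trans (by rw [if_pos hp]) (Finset.single_le_sum
        (f := fun p => (if MeetsTwice f f' p then 1 else 0 : ℝ)) (fun q _ => ?_)
        (Finset.mem_univ p))
      split_ifs <;> simp
    refine le_trans ?_ (le_mul_of_one_le_right hB h1)
    refine (abs_sub _ _).trans (add_le_add (abs_indicatorCov_le_one σ τ f f') ?_)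
    refine (Finset.abs_sum_le_sum_abs _ _).trans (Finset.sum_le_sum fun i _ => ?_)
    refine (Finset.abs_sum_le_sum_abs _ _).trans (Finset.sum_le_sum fun j _ => ?_)
    split_ifs <;> simp
  · refine le_trans (le_of_eq ?_) (mul_nonneg hB (Finset.sum_nonneg fun q _ => ?_))
    · rw [abs_eq_zero, sub_eq_zero]
      by_cases hm : ∃ i j, f i = f' j
      · obtain ⟨i, j, hij⟩ := hm
        have huniq : ∀ a b, f a = f' b → a = i ∧ b = j := by
          intro a b hab
          have hbj : b = j := by
            by_contra hbj
            exact hp ⟨((a, i), (b, j)), hbj, hab.symm, hij.symm⟩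
          exact ⟨f.injective (by rw [hab, hij, hbj]), hbj⟩
        rw [Finset.sum_eq_single i, Finset.sum_eq_single j, if_pos hij, mul_one, indicatorCov,
          jointProb_of_inter 1 1 f f' i j hij huniq, jointProb_of_inter σ τ f f' i j hij huniq,
          meetCov]
        · rfl
        · intro b _ hb
          rw [if_neg fun h => hb (huniq _ _ h).2, mul_zero]
        · simp
        · intro a _ ha
          exact Finset.sum_eq_zero fun b _ => by
            rw [if_neg fun h => ha (huniq _ _ h).1, mul_zero]
        · simp
      · push Not at hm
        rw [indicatorCov, jointProb_of_disjoint 1 1 f f' hm, jointProb_of_disjoint σ τ f f' hm]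
        simp [hm, sq]
    · split_ifs <;> simp

theorem abs_sum_indicatorCov_sub_le {k l n : ℕ} (hn : n ≠ 0) (σ : Equiv.Perm (Fin k))
    (τ : Equiv.Perm (Fin l)) :
    |∑ f : Fin k ↪ Fin n, ∑ f' : Fin l ↪ Fin n, indicatorCov σ τ f f' -
        (∑ i : Fin k, ∑ j : Fin l, meetCov σ τ i j) *
          (n.descFactorial k * n.descFactorial l / n)| ≤
      (1 + ∑ i : Fin k, ∑ j : Fin l, |meetCov σ τ i j|) *
        Fintype.card ((Fin k × Fin k) × Fin l × Fin l) * (n ^ (k + l) / n ^ 2) := by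
  have hn' : (0 : ℝ) < n := by positivity
  have h1 : (∑ i : Fin k, ∑ j : Fin l, meetCov σ τ i j) *
          (n.descFactorial k * n.descFactorial l / n : ℝ) =
      ∑ f : Fin k ↪ Fin n, ∑ f' : Fin l ↪ Fin n,
        ∑ i : Fin k, ∑ j : Fin l, meetCov σ τ i j * (if f i = f' j then 1 else 0) := by
    have e : ∀ f : Fin k ↪ Fin n, ∑ f' : Fin l ↪ Fin n, ∑ i : Fin k, ∑ j : Fin l,
        meetCov σ τ i j * (if f i = f' j then 1 else 0) = ∑ i : Fin k, ∑ j : Fin l,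
          ∑ f' : Fin l ↪ Fin n, meetCov σ τ i j * (if f i = f' j then 1 else 0) := by
      intro f
      rw [Finset.sum_comm]
      exact Finset.sum_congr rfl fun i _ => Finset.sum_comm
    rw [Finset.sum_mul, Finset.sum_congr rfl fun f _ => e f, Finset.sum_comm]
    refine Finset.sum_congr rfl fun i _ => ?_
    rw [Finset.sum_mul, Finset.sum_comm]
    refine Finset.sum_congr rfl fun j _ => ?_
    simp only [← Finset.mul_sum]
    rw [← sum_sum_embedding_apply_eq i j, mul_div_cancel_left₀ _ hn'.ne']
  rw [h1, ← Finset.sum_sub_distrib]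
  simp only [← Finset.sum_sub_distrib]
  refine (Finset.abs_sum_le_sum_abs _ _).trans ((Finset.sum_le_sum fun f _ =>
    (Finset.abs_sum_le_sum_abs _ _).trans (Finset.sum_le_sum fun f' _ =>
      abs_indicatorCov_sub_le σ τ f f')).trans ?_)
  simp only [← Finset.mul_sum]
  rw [mul_assoc]
  refine mul_le_mul_of_nonneg_left ?_ (by positivity)
  have e : ∀ f : Fin k ↪ Fin n, ∑ f' : Fin l ↪ Fin n, ∑ p,
      (if MeetsTwice f f' p then 1 else 0 : ℝ) =
        ∑ p, ∑ f' : Fin l ↪ Fin n, (if MeetsTwice f f' p then 1 else 0) :=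
    fun f => Finset.sum_comm
  rw [Finset.sum_congr rfl fun f _ => e f, Finset.sum_comm]
  refine (Finset.sum_le_card_nsmul _ _ _ fun p _ => ?_).trans_eq (by rw [nsmul_eq_mul]; rfl)
  rw [le_div_iff₀ (by positivity)]
  exact sum_sum_meetsTwice_le p

theorem tendsto_descFactorial_div_pow (k : ℕ) :
    Tendsto (fun n : ℕ => (n.descFactorial k : ℝ) / n ^ k) atTop (nhds 1) := by
  induction k with
  | zero => simp
  | succ k ih =>
    have h : Tendsto (fun n : ℕ => ((n - k : ℕ) : ℝ) / n) atTop (nhds 1) := by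
      have h0 : Tendsto (fun n : ℕ => 1 - (k : ℝ) / n) atTop (nhds 1) := by
        simpa using tendsto_const_nhds.sub (tendsto_const_div_atTop_nhds_zero_nat (k : ℝ))
      refine h0.congr' ?_
      filter_upwards [eventually_ge_atTop (k + 1)] with n hn
      have : (n : ℝ) ≠ 0 := by
        have : n ≠ 0 := by omega
        exact_mod_cast this
      rw [Nat.cast_sub (by omega)]
      field_simp
    refine ((h.mul ih).congr fun n => ?_).trans (by rw [one_mul])
    rw [Nat.descFactorial_succ, pow_succ]
    push_cast
    rw [div_mul_div_comm, mul_comm (n : ℝ)]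

theorem occ_eq_sum {k n : ℕ} (σ : Equiv.Perm (Fin k)) (π ρ : Equiv.Perm (Fin n)) :
    (occ σ (π * ρ⁻¹) : ℝ) = ∑ f : Fin k ↪ Fin n,
      if HasPattern 1 (ρ ∘ f) ∧ HasPattern σ (π ∘ f) then 1 else 0 := by
  rw [Finset.sum_boole, occ]
  congr 1
  symm
  refine Finset.card_bij (fun f _ => ρ ∘ f) ?_ ?_ ?_
  · intro f hf
    simp only [Finset.mem_filter, Finset.mem_univ, true_and] at hf ⊢
    refine ⟨fun a b hab => (hf.1 a b).2 hab, fun a b => ?_⟩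
    simpa using hf.2 a b
  · intro f _ f' _ h
    ext a
    have := congrFun h a
    simp only [Function.comp_apply, EmbeddingLike.apply_eq_iff_eq] at this
    rw [this]
  · intro h hh
    simp only [Finset.mem_filter, Finset.mem_univ, true_and] at hh
    have hm : StrictMono h := fun a b => hh.1 a b
    refine ⟨⟨ρ.symm ∘ h, ρ.symm.injective.comp hm.injective⟩, ?_, ?_⟩
    · simp only [Finset.mem_filter, Finset.mem_univ, true_and]
      refine ⟨fun a b => ?_, fun a b => ?_⟩
      · simpa using hm.lt_iff_lt
      · simpa using hh.2 a b
    · ext a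
      simp

theorem sum_sum_indicator {k l n : ℕ} (σ : Equiv.Perm (Fin k)) (τ : Equiv.Perm (Fin l))
    (f : Fin k ↪ Fin n) (f' : Fin l ↪ Fin n) :
    ∑ ρ : Equiv.Perm (Fin n), ∑ π : Equiv.Perm (Fin n),
      (if HasPattern 1 (ρ ∘ f) ∧ HasPattern σ (π ∘ f) then 1 else 0 : ℝ) *
        (if HasPattern 1 (ρ ∘ f') ∧ HasPattern τ (π ∘ f') then 1 else 0) =
      (n.factorial : ℝ) ^ 2 * (jointProb 1 1 f f' * jointProb σ τ f f') := by
  have h : (n.factorial : ℝ) ^ 2 * (jointProb 1 1 f f' * jointProb σ τ f f') =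
      jointCount 1 1 f f' * jointCount σ τ f f' := by
    unfold jointProb
    field_simp
  rw [h, jointCount, jointCount, ← Finset.sum_boole, ← Finset.sum_boole, Finset.sum_mul_sum]
  refine Finset.sum_congr rfl fun ρ _ => Finset.sum_congr rfl fun π _ => ?_
  by_cases h1 : HasPattern 1 (ρ ∘ f) <;> by_cases h2 : HasPattern σ (π ∘ f) <;>
    by_cases h3 : HasPattern 1 (ρ ∘ f') <;> by_cases h4 : HasPattern τ (π ∘ f') <;>
    simp [h1, h2, h3, h4]

theorem sum_sum_indicator_single {k n : ℕ} (σ : Equiv.Perm (Fin k)) (f : Fin k ↪ Fin n) :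
    ∑ ρ : Equiv.Perm (Fin n), ∑ π : Equiv.Perm (Fin n),
      (if HasPattern 1 (ρ ∘ f) ∧ HasPattern σ (π ∘ f) then 1 else 0 : ℝ) =
      (n.factorial : ℝ) ^ 2 * (1 / k.factorial) ^ 2 := by
  let f₀ : Fin 0 ↪ Fin n := ⟨fun a => a.elim0, fun a => a.elim0⟩
  have h := sum_sum_indicator σ (1 : Equiv.Perm (Fin 0)) f f₀
  have h0 : ∀ π : Equiv.Perm (Fin n), HasPattern (1 : Equiv.Perm (Fin 0)) (π ∘ f₀) :=
    fun π a => a.elim0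
  rw [jointProb_of_disjoint _ _ _ _ fun _ b => b.elim0,
    jointProb_of_disjoint _ _ _ _ fun _ b => b.elim0] at h
  simpa [h0, sq] using h

theorem occ_sub_mean {k n : ℕ} (σ : Equiv.Perm (Fin k)) (π ρ : Equiv.Perm (Fin n)) :
    (occ σ (π * ρ⁻¹) : ℝ) - n.choose k / k.factorial = ∑ f : Fin k ↪ Fin n,
      ((if HasPattern 1 (ρ ∘ f) ∧ HasPattern σ (π ∘ f) then 1 else 0) -
        (1 / (k.factorial : ℝ)) ^ 2) := by
  rw [Finset.sum_sub_distrib, ← occ_eq_sum, Finset.sum_const, Finset.card_univ,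
    Fintype.card_embedding_eq, Fintype.card_fin, Fintype.card_fin,
    Nat.descFactorial_eq_factorial_mul_choose, nsmul_eq_mul]
  push_cast
  congr 1
  field_simp

theorem covariance_eq_sum_indicatorCov {k l : ℕ} (n : ℕ) (σ : Equiv.Perm (Fin k))
    (τ : Equiv.Perm (Fin l)) :
    (1 / (n.factorial : ℝ)) * ∑ π : Equiv.Perm (Fin n),
        ((occ σ π : ℝ) - (n.choose k : ℝ) / (k.factorial : ℝ))
          * ((occ τ π : ℝ) - (n.choose l : ℝ) / (l.factorial : ℝ)) =
      ∑ f : Fin k ↪ Fin n, ∑ f' : Fin l ↪ Fin n, indicatorCov σ τ f f' := by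
  set s := ∑ π : Equiv.Perm (Fin n), ((occ σ π : ℝ) - (n.choose k : ℝ) / (k.factorial : ℝ))
          * ((occ τ π : ℝ) - (n.choose l : ℝ) / (l.factorial : ℝ)) with hs
  have h1 : ∀ ρ : Equiv.Perm (Fin n), ∑ π : Equiv.Perm (Fin n),
      ((occ σ (π * ρ⁻¹) : ℝ) - n.choose k / k.factorial) *
        ((occ τ (π * ρ⁻¹) : ℝ) - n.choose l / l.factorial) = s := fun ρ =>
    Equiv.sum_comp (Equiv.mulRight ρ⁻¹) fun π : Equiv.Perm (Fin n) =>
      ((occ σ π : ℝ) - n.choose k / k.factorial) * ((occ τ π : ℝ) - n.choose l / l.factorial)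
  have h2 : ∑ ρ : Equiv.Perm (Fin n), ∑ π : Equiv.Perm (Fin n),
      ((occ σ (π * ρ⁻¹) : ℝ) - n.choose k / k.factorial) *
        ((occ τ (π * ρ⁻¹) : ℝ) - n.choose l / l.factorial) = n.factorial * s := by
    rw [Finset.sum_congr rfl fun ρ _ => h1 ρ, Finset.sum_const, Finset.card_univ,
      Fintype.card_perm, Fintype.card_fin, nsmul_eq_mul]
  have h3 : ∑ ρ : Equiv.Perm (Fin n), ∑ π : Equiv.Perm (Fin n),
      ((occ σ (π * ρ⁻¹) : ℝ) - n.choose k / k.factorial) *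
        ((occ τ (π * ρ⁻¹) : ℝ) - n.choose l / l.factorial) =
      (n.factorial : ℝ) ^ 2 *
        ∑ f : Fin k ↪ Fin n, ∑ f' : Fin l ↪ Fin n, indicatorCov σ τ f f' := by
    simp only [occ_sub_mean, Finset.sum_mul_sum]
    have e : ∀ F : Equiv.Perm (Fin n) → (Fin k ↪ Fin n) →
        (Fin l ↪ Fin n) → ℝ, ∑ π, ∑ f, ∑ f', F π f f' = ∑ f, ∑ f', ∑ π, F π f f' := by
      intro F
      rw [Finset.sum_comm]
      exact Finset.sum_congr rfl fun f _ => Finset.sum_comm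
    rw [Finset.sum_congr rfl fun ρ _ => e _, e, Finset.mul_sum]
    refine Finset.sum_congr rfl fun f _ => ?_
    rw [Finset.mul_sum]
    refine Finset.sum_congr rfl fun f' _ => ?_
    simp only [sub_mul, mul_sub, Finset.sum_sub_distrib]
    rw [sum_sum_indicator]
    simp only [← Finset.sum_mul, ← Finset.mul_sum]
    rw [sum_sum_indicator_single, sum_sum_indicator_single, indicatorCov]
    simp only [Finset.sum_const, Finset.card_univ, Fintype.card_perm, Fintype.card_fin,
      nsmul_eq_mul]
    field_simp
    ring
  have h4 := h2.symm.trans h3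
  have hn : (n.factorial : ℝ) ≠ 0 := by positivity
  field_simp
  rw [sq, mul_assoc] at h4
  exact mul_left_cancel₀ hn h4

/-- The covariance of the pattern counts of `σ` and `τ` under the uniform distribution on
`S_n`, divided by `n^{k+ℓ-1}`, converges to `Σ_{σ,τ} = ∫₀¹∫₀¹ G_σ(x,y) G_τ(x,y) dx dy`. -/
theorem stmt19 (k l : ℕ) (hk : 1 ≤ k) (hl : 1 ≤ l)
    (σ : Equiv.Perm (Fin k)) (τ : Equiv.Perm (Fin l)) :
    Tendsto (fun n : ℕ =>
        ((1 / (n.factorial : ℝ)) * ∑ π : Equiv.Perm (Fin n),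
            ((occ σ π : ℝ) - (n.choose k : ℝ) / (k.factorial : ℝ))
              * ((occ τ π : ℝ) - (n.choose l : ℝ) / (l.factorial : ℝ)))
          / (n : ℝ) ^ (k + l - 1))
      atTop
      (nhds (∫ x in (0:ℝ)..1, ∫ y in (0:ℝ)..1, G σ x y * G τ x y)) := by
  set w := ∑ i : Fin k, ∑ j : Fin l, meetCov σ τ i j with hw
  have hlim : ∫ x in (0:ℝ)..1, ∫ y in (0:ℝ)..1, G σ x y * G τ x y = w :=
    integral_G_mul_G hk hl σ τ
  simp only [covariance_eq_sum_indicatorCov]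
  rw [hlim]
  set B := (1 + ∑ i : Fin k, ∑ j : Fin l, |meetCov σ τ i j|) *
        Fintype.card ((Fin k × Fin k) × Fin l × Fin l) with hB
  have hpow : ∀ n : ℕ, (n : ℝ) ^ (k + l) = n ^ (k + l - 1) * n := fun n => by
    rw [← pow_succ, Nat.sub_add_cancel (by omega)]
  have hmain : Tendsto (fun n : ℕ => w * (((n.descFactorial k : ℝ) / n ^ k) *
      ((n.descFactorial l : ℝ) / n ^ l))) atTop (nhds w) := by
    simpa using ((tendsto_descFactorial_div_pow k).mul
      (tendsto_descFactorial_div_pow l)).const_mul w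
  have hdiff : Tendsto (fun n : ℕ =>
      (∑ f : Fin k ↪ Fin n, ∑ f' : Fin l ↪ Fin n, indicatorCov σ τ f f') / (n : ℝ) ^ (k + l - 1)
        - w * (((n.descFactorial k : ℝ) / n ^ k) * ((n.descFactorial l : ℝ) / n ^ l)))
      atTop (nhds 0) := by
    refine squeeze_zero_norm' ?_ (tendsto_const_div_atTop_nhds_zero_nat B)
    filter_upwards [eventually_gt_atTop 0] with n hn
    have hn' : (0 : ℝ) < n := by exact_mod_cast hn
    have h := abs_sum_indicatorCov_sub_le hn.ne' σ τ
    rw [← hw, ← hB, hpow] at h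
    have e : w * (((n.descFactorial k : ℝ) / n ^ k) * ((n.descFactorial l : ℝ) / n ^ l)) =
        w * (n.descFactorial k * n.descFactorial l / n) / (n : ℝ) ^ (k + l - 1) := by
      rw [div_mul_div_comm, ← pow_add, hpow]
      field_simp
    rw [e, ← sub_div, Real.norm_eq_abs, abs_div, abs_of_pos (pow_pos hn' (k + l - 1)),
      div_le_iff₀ (by positivity)]
    refine h.trans_eq ?_
    field_simp
  simpa using hdiff.add hmain
end
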